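/- arXiv:0804.2841 — 4 statements merged into one kernel-verified Lean document; each statement's English description precedes it below -/
import Mathlib

section
/- Let K be a field, m ≥ 1, and let G be a subgroup of GL_m(K) (i.e., G is a linear group). Then for every n ≥ 1, every point of the space L_n(G) of G-limit kernels has finite Cantor–Bendixson rank in L_n(G): for each N ∈ L_n(G) there exists k ∈ ℕ with N ∉ D^k(L_n(G)). Equivalently, every finitely generated model of the universal theory of G (every finitely generated G-limit group) has finite rank Rk. -/
/-- The characteristic function of a subset, identifying `2^G` with `G → Bool`. -/
noncomputable def chi {G : Type*} (s : Set G) : G → Bool :=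
  fun g => @decide (g ∈ s) (Classical.propDecidable _)

/-- `cbD A` is the set of points of `A` that are accumulation points of `A`,
i.e. the non-isolated points of the subspace `A`.  Its iterates `cbD^[k] A`
are the finite Cantor–Bendixson derivatives `D^k(A)`. -/
def cbD {X : Type*} [TopologicalSpace X] (A : Set X) : Set X :=
  A ∩ derivedSet A

/-- `N` is a `G`-limit kernel if for all finite `P⁺ ⊆ N` and `P⁻ ⊆ F_n \ N` there
is a homomorphism `φ : F_n → G` with `P⁺ ⊆ ker φ` and `P⁻ ∩ ker φ = ∅`. -/
def GLimitKernel (G : Type*) [Group G] (n : ℕ) (N : Subgroup (FreeGroup (Fin n))) : Prop :=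
  ∀ Pp Pm : Finset (FreeGroup (Fin n)),
    (↑Pp ⊆ (N : Set (FreeGroup (Fin n)))) → (↑Pm ⊆ (N : Set (FreeGroup (Fin n)))ᶜ) →
      ∃ φ : FreeGroup (Fin n) →* G,
        (∀ w ∈ Pp, w ∈ φ.ker) ∧ ∀ w ∈ Pm, w ∉ φ.ker

/-- `LnSetG G n` is the space `L_n(G)` of (characteristic functions of) `G`-limit
kernels, inside `2^{F_n}` with the product topology. -/
def LnSetG (G : Type*) [Group G] (n : ℕ) : Set (FreeGroup (Fin n) → Bool) :=
  {f | ∃ N : Subgroup (FreeGroup (Fin n)), N.Normal ∧ GLimitKernel G n N ∧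
    f = chi (N : Set (FreeGroup (Fin n)))}

open TopologicalSpace Topology

/-- The finite data attached to a set `{f = true}` of words, with a Noetherian topology
on the representation space. -/
theorem aux_nbhd {X W : Type*} [TopologicalSpace X] [NoetherianSpace X]
    (Z : W → Set X) (hZ : ∀ w, IsClosed (Z w)) (f : W → Bool) :
    ∃ Pp Pm : Finset W, (∀ w ∈ Pp, f w = true) ∧ (∀ w ∈ Pm, f w = false) ∧
      ∀ D : IrreducibleCloseds X, (∀ w ∈ Pp, (D : Set X) ⊆ Z w) →
        (∀ w ∈ Pm, ¬ (D : Set X) ⊆ Z w) →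
        ∃ C : IrreducibleCloseds X, D ≤ C ∧ ∀ w, f w = true ↔ (C : Set X) ⊆ Z w := by
  classical
  let V : Set X := ⋂ w : {w // f w = true}, Z w
  have hV : IsClosed V := isClosed_iInter fun w => hZ w
  obtain ⟨T, hT⟩ := (NoetherianSpace.isCompact Vᶜ).elim_finite_subcover
    (fun w : {w // f w = true} => (Z w)ᶜ) (fun w => (hZ w).isOpen_compl)
    (by intro x hx; simpa [V] using hx)
  obtain ⟨S, hSf, hSc, hSi, hS⟩ :=
    NoetherianSpace.exists_finite_set_isClosed_irreducible hV
  have hex : ∀ t : Set X, ∃ P : Finset W, (∀ w ∈ P, f w = false) ∧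
      ((∃ w ∈ P, t ⊆ Z w) ∨ ∀ w, t ⊆ Z w → f w = true) := by
    intro t
    by_cases h : ∀ w, t ⊆ Z w → f w = true
    · exact ⟨∅, by simp, Or.inr h⟩
    · push Not at h
      obtain ⟨w, h1, h2⟩ := h
      exact ⟨{w}, by simpa using h2, Or.inl ⟨w, by simp, h1⟩⟩
  choose P hP1 hP2 using hex
  refine ⟨T.image Subtype.val, hSf.toFinset.biUnion P, ?_, ?_, ?_⟩
  · intro w hw
    obtain ⟨a, -, rfl⟩ := Finset.mem_image.1 hw
    exact a.2
  · intro w hw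
    obtain ⟨t, -, ht⟩ := Finset.mem_biUnion.1 hw
    exact hP1 t w ht
  · intro D h1 h2
    have hDV : (D : Set X) ⊆ ⋃₀ S := by
      rw [← hS]
      intro x hx
      by_contra hxV
      obtain ⟨w, hwT, hw⟩ := Set.mem_iUnion₂.1 (hT hxV)
      exact hw (h1 w (Finset.mem_image_of_mem _ hwT) hx)
    obtain ⟨t, htS, hDt⟩ := (isIrreducible_iff_sUnion_isClosed.1 D.isIrreducible)
      hSf.toFinset (fun t ht => hSc t (hSf.mem_toFinset.1 ht)) (by simpa using hDV)
    rw [hSf.mem_toFinset] at htS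
    refine ⟨⟨t, hSi t htS, hSc t htS⟩, hDt, fun w => ⟨fun hw => ?_, fun hw => ?_⟩⟩
    · have : t ⊆ V := hS ▸ Set.subset_sUnion_of_mem htS
      exact this.trans (Set.iInter_subset (fun w : {w // f w = true} => Z w) ⟨w, hw⟩)
    · rcases hP2 t with ⟨w', hw', h⟩ | h
      · exact absurd (hDt.trans h)
          (h2 w' (Finset.mem_biUnion.2 ⟨t, hSf.mem_toFinset.2 htS, hw'⟩))
      · exact h w hw

theorem aux_rank (G : Type*) [Group G] (n : ℕ)
    [TopologicalSpace (FreeGroup (Fin n) →* G)] [NoetherianSpace (FreeGroup (Fin n) →* G)]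
    (hZ : ∀ w, IsClosed {φ : FreeGroup (Fin n) →* G | φ w = 1}) (k : ℕ) :
    ∀ f ∈ cbD^[k] (LnSetG G n), ∃ C : IrreducibleCloseds (FreeGroup (Fin n) →* G),
      (k : ℕ∞) ≤ Order.height C ∧
      ∀ w, f w = true ↔ (C : Set (FreeGroup (Fin n) →* G)) ⊆ {φ | φ w = 1} := by
  classical
  induction k with
  | zero =>
    rintro f ⟨N, -, hN, rfl⟩
    obtain ⟨Pp, Pm, h1, h2, h3⟩ := aux_nbhd
      (fun w => {φ : FreeGroup (Fin n) →* G | φ w = 1}) hZ (chi (N : Set (FreeGroup (Fin n))))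
    obtain ⟨φ, hp, hm⟩ := hN Pp Pm (fun w hw => by simpa [chi] using h1 w hw)
      (fun w hw => by simpa [chi] using h2 w hw)
    obtain ⟨C, -, hC⟩ := h3 ⟨closure {φ}, isIrreducible_singleton.closure, isClosed_closure⟩
      (fun w hw => closure_minimal (by simpa using hp w hw) (hZ w))
      (fun w hw h => hm w hw (h (subset_closure rfl)))
    exact ⟨C, by simp, hC⟩
  | succ k ih =>
    intro f hf
    rw [Function.iterate_succ_apply'] at hf
    obtain ⟨Pp, Pm, h1, h2, h3⟩ := aux_nbhd
      (fun w => {φ : FreeGroup (Fin n) →* G | φ w = 1}) hZ f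
    have hU : {g : FreeGroup (Fin n) → Bool | ∀ w ∈ Pp ∪ Pm, g w = f w} ∈ 𝓝 f := by
      apply IsOpen.mem_nhds
      · have : {g : FreeGroup (Fin n) → Bool | ∀ w ∈ Pp ∪ Pm, g w = f w} =
            ⋂ w ∈ Pp ∪ Pm, {g | g w = f w} := by ext; simp
        rw [this]
        refine isOpen_biInter_finset fun w _ => ?_
        have hc : Continuous fun g : FreeGroup (Fin n) → Bool => g w := continuous_apply w
        exact (isOpen_discrete ({f w} : Set Bool)).preimage hc
      · intro w _
        rfl
    obtain ⟨g, ⟨hgU, hgA⟩, hgf⟩ := accPt_iff_nhds.1 hf.2 _ hU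
    obtain ⟨D, hDk, hD⟩ := ih g hgA
    obtain ⟨C, hDC, hC⟩ := h3 D
      (fun w hw => (hD w).1 (by rw [hgU w (Finset.mem_union_left _ hw), h1 w hw]))
      (fun w hw h => by
        have := (hD w).2 h
        rw [hgU w (Finset.mem_union_right _ hw), h2 w hw] at this
        exact absurd this (by simp))
    have hne : D ≠ C := by
      rintro rfl
      apply hgf
      funext w
      rw [Bool.eq_iff_iff, hC w, hD w]
    refine ⟨C, ?_, hC⟩
    push_cast
    exact (add_le_add_left hDk 1).trans (Order.height_add_one_le (lt_of_le_of_ne hDC hne))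

/-- The coordinates of a representation. -/
def aux_coord {K : Type*} [Field K] {m n : ℕ} (G : Subgroup (GL (Fin m) K))
    (φ : FreeGroup (Fin n) →* G) : Fin n × Bool × Fin m × Fin m → K :=
  fun i => ((φ (bif i.2.1 then FreeGroup.of i.1 else (FreeGroup.of i.1)⁻¹) : GL (Fin m) K) :
    Matrix (Fin m) (Fin m) K) i.2.2.1 i.2.2.2

theorem aux_entry {K : Type*} [Field K] {m n : ℕ} (G : Subgroup (GL (Fin m) K))
    (w : FreeGroup (Fin n)) : ∀ i j, ∃ p : MvPolynomial (Fin n × Bool × Fin m × Fin m) K,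
      ∀ φ : FreeGroup (Fin n) →* G, MvPolynomial.eval (aux_coord G φ) p =
        ((φ w : GL (Fin m) K) : Matrix (Fin m) (Fin m) K) i j := by
  induction w using FreeGroup.induction_on with
  | C1 =>
    intro i j
    exact ⟨MvPolynomial.C ((1 : Matrix (Fin m) (Fin m) K) i j), fun φ => by simp⟩
  | of x =>
    intro i j
    exact ⟨MvPolynomial.X (x, true, i, j), fun φ => by simp [aux_coord]⟩
  | inv_of x _ =>
    intro i j
    exact ⟨MvPolynomial.X (x, false, i, j), fun φ => by
      rw [MvPolynomial.eval_X]; rfl⟩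
  | mul x y hx hy =>
    intro i j
    choose p hp using hx
    choose q hq using hy
    refine ⟨∑ l, p i l * q l j, fun φ => ?_⟩
    rw [map_mul, Subgroup.coe_mul, Units.val_mul, Matrix.mul_apply]
    simp [hp, hq]

/-- If `G` is a linear group (a subgroup of `GL_m(K)` for a field `K`), then every
point of `L_n(G)` has finite Cantor–Bendixson rank in `L_n(G)`: equivalently, every
finitely generated `G`-limit group has finite rank `Rk`. -/
theorem linear_G_limit_kernels_finite_CB_rank (K : Type*) [Field K] (m : ℕ) (hm : 1 ≤ m)
    (G : Subgroup (GL (Fin m) K)) (n : ℕ) (hn : 1 ≤ n) :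
    ∀ f ∈ LnSetG G n, ∃ k : ℕ, f ∉ cbD^[k] (LnSetG G n) := by
  intro f _
  let ι : (FreeGroup (Fin n) →* G) →
      PrimeSpectrum (MvPolynomial (Fin n × Bool × Fin m × Fin m) K) :=
    fun φ => ⟨RingHom.ker (MvPolynomial.eval (aux_coord G φ)), RingHom.ker_isPrime _⟩
  let : TopologicalSpace (FreeGroup (Fin n) →* G) := TopologicalSpace.induced ι inferInstance
  have hι : IsInducing ι := ⟨rfl⟩
  have : NoetherianSpace (FreeGroup (Fin n) →* G) := hι.noetherianSpace
  have hZ : ∀ w, IsClosed {φ : FreeGroup (Fin n) →* G | φ w = 1} := by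
    intro w
    choose p hp using aux_entry G w
    have : {φ : FreeGroup (Fin n) →* G | φ w = 1} = ⋂ i, ⋂ j, ι ⁻¹'
        PrimeSpectrum.zeroLocus
          {p i j - MvPolynomial.C ((1 : Matrix (Fin m) (Fin m) K) i j)} := by
      ext φ
      simp only [Set.mem_ofPred_eq, Set.mem_iInter, Set.mem_preimage,
        PrimeSpectrum.mem_zeroLocus, Set.singleton_subset_iff, SetLike.mem_coe, ι,
        RingHom.mem_ker, map_sub, hp, MvPolynomial.eval_C, sub_eq_zero]
      constructor
      · intro h i j
        rw [h]
        rfl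
      · intro h
        exact Subtype.ext (Units.ext (Matrix.ext h))
    rw [this]
    exact isClosed_iInter fun i => isClosed_iInter fun j =>
      (PrimeSpectrum.isClosed_zeroLocus _).preimage hι.continuous
  have hdim := hι.topologicalKrullDim_le
  rw [PrimeSpectrum.topologicalKrullDim_eq_ringKrullDim,
    MvPolynomial.ringKrullDim_of_isNoetherianRing, ringKrullDim_eq_zero_of_field,
    zero_add] at hdim
  refine ⟨Nat.card (Fin n × Bool × Fin m × Fin m) + 1, fun hf => ?_⟩
  obtain ⟨C, hC, -⟩ := aux_rank G n hZ _ f hf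
  have h1 := (Order.height_le_krullDim C).trans hdim
  have h2 : Order.height C ≤ (Nat.card (Fin n × Bool × Fin m × Fin m) : ℕ∞) := by
    exact_mod_cast h1
  have h3 := hC.trans h2
  have h4 : Nat.card (Fin n × Bool × Fin m × Fin m) + 1 ≤
    Nat.card (Fin n × Bool × Fin m × Fin m) := by exact_mod_cast h3
  omega
end

section
/- For every n ≥ 1, every point of the space L_n of limit-group kernels has finite Cantor–Bendixson rank in L_n: for each normal subgroup N of F_n with F_n/N fully residually free, there exists k ∈ ℕ with N ∉ D^k(L_n). Equivalently, the Cantor–Bendixson rank of every limit group is finite. -/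
/-- A group `L` is fully residually free if for every finite subset `S ⊆ L` there
is a homomorphism `φ` to a free group of rank 2 with `φ s ≠ 1` for all `s ∈ S`, `s ≠ 1`. -/
def FullyResiduallyFree (L : Type*) [Group L] : Prop :=
  ∀ S : Finset L, ∃ φ : L →* FreeGroup (Fin 2), ∀ s ∈ S, s ≠ 1 → φ s ≠ 1

/-- `LnSet n` is the set of (characteristic functions of) normal subgroups `N` of
`F_n` such that `F_n / N` is fully residually free, inside `2^{F_n}` with the
product topology. -/
def LnSet (n : ℕ) : Set (FreeGroup (Fin n) → Bool) :=
  {f | ∃ N : Subgroup (FreeGroup (Fin n)), ∃ hN : N.Normal,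
    @FullyResiduallyFree (FreeGroup (Fin n) ⧸ N) (@QuotientGroup.Quotient.group _ _ N hN) ∧
      f = chi (N : Set (FreeGroup (Fin n)))}

section

open Filter Topology MatrixGroups UpperHalfPlane Pointwise

theorem lgcb_ultra {R α : Type*} [CommRing R] [IsNoetherianRing R] (U : Ultrafilter α)
    (P : α → PrimeSpectrum R) : ∃ Q : PrimeSpectrum R,
      (∀ f, f ∈ Q.asIdeal ↔ ∀ᶠ a in (U : Filter α), f ∈ (P a).asIdeal) ∧
      ∀ᶠ a in (U : Filter α), Q ≤ P a := by
  let J : Ideal R :=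
    { carrier := {f | ∀ᶠ a in (U : Filter α), f ∈ (P a).asIdeal}
      add_mem' := by
        intro f g hf hg
        filter_upwards [hf, hg] with a h1 h2
        exact Ideal.add_mem _ h1 h2
      zero_mem' := by
        refine Eventually.of_forall fun a => Ideal.zero_mem _
      smul_mem' := by
        intro c f hf
        filter_upwards [hf] with a h1
        exact Ideal.mul_mem_left _ _ h1 }
  have hJ : ∀ f, f ∈ J ↔ ∀ᶠ a in (U : Filter α), f ∈ (P a).asIdeal := fun f => Iff.rfl
  have hp : J.IsPrime := by
    refine ⟨?_, ?_⟩
    · rw [Ideal.ne_top_iff_one, hJ]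
      intro h
      obtain ⟨a, ha⟩ := h.exists
      exact (Ideal.ne_top_iff_one _).1 (P a).isPrime.ne_top ha
    · intro f g h
      rw [hJ] at h
      rw [hJ, hJ, ← Ultrafilter.eventually_or]
      filter_upwards [h] with a ha
      exact (P a).isPrime.mem_or_mem ha
  refine ⟨⟨J, hp⟩, hJ, ?_⟩
  obtain ⟨s, hs⟩ := (isNoetherianRing_iff_ideal_fg R).1 inferInstance J
  have h : ∀ᶠ a in (U : Filter α), ∀ f ∈ s, f ∈ (P a).asIdeal := by
    rw [Filter.eventually_all_finset]
    intro f hf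
    rw [← hJ, ← hs]
    exact Submodule.subset_span hf
  filter_upwards [h] with a ha
  change J ≤ (P a).asIdeal
  rw [← hs]
  exact Submodule.span_le.2 ha

/-- The characteristic function of the kernel of a representation modulo a prime. -/
noncomputable def lgcbKern {F R : Type*} [Group F] [CommRing R]
    (ρ : F →* Matrix.SpecialLinearGroup (Fin 2) R) (P : PrimeSpectrum R) : F → Bool :=
  chi {w | ∀ i j, (ρ w).1 i j - (1 : Matrix (Fin 2) (Fin 2) R) i j ∈ P.asIdeal}

theorem lgcb_chi {G : Type*} (s : Set G) (g : G) : chi s g = true ↔ g ∈ s := by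
  simp [chi]

theorem lgcb_limit {F R α : Type*} [Group F] [CommRing R] [IsNoetherianRing R]
    (ρ : F →* Matrix.SpecialLinearGroup (Fin 2) R) (U : Ultrafilter α)
    (P : α → PrimeSpectrum R) (x : F → Bool)
    (hx : Tendsto (fun a => lgcbKern ρ (P a)) U (𝓝 x)) :
    ∃ Q : PrimeSpectrum R, lgcbKern ρ Q = x ∧ ∀ᶠ a in (U : Filter α), Q ≤ P a := by
  obtain ⟨Q, hQ, hle⟩ := lgcb_ultra U P
  refine ⟨Q, ?_, hle⟩
  funext w
  have h1 : ∀ᶠ a in (U : Filter α), lgcbKern ρ (P a) w = x w := by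
    have := (tendsto_pi_nhds.1 hx) w
    rw [nhds_discrete, tendsto_pure] at this
    exact this
  rw [Bool.eq_iff_iff, lgcbKern, lgcb_chi]
  simp only [Set.mem_ofPred_eq, hQ]
  simp only [← Filter.eventually_all]
  have h2 : ∀ᶠ a in (U : Filter α), ((∀ i j, (ρ w).1 i j - (1 : Matrix (Fin 2) (Fin 2) R) i j ∈
      (P a).asIdeal) ↔ x w = true) := by
    filter_upwards [h1] with a ha
    rw [← ha, lgcbKern, lgcb_chi]
    rfl
  rw [Filter.eventually_congr h2]
  simp

theorem lgcb_rank {F R : Type*} [Group F] [CommRing R] [IsNoetherianRing R]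
    (ρ : F →* Matrix.SpecialLinearGroup (Fin 2) R) (A : Set (F → Bool))
    (hA : ∀ x ∈ A, ∃ P, lgcbKern ρ P = x) (k : ℕ) :
    ∀ x ∈ cbD^[k] A, ∃ P, lgcbKern ρ P = x ∧ (k : ℕ∞) ≤ Order.coheight P := by
  induction k with
  | zero => intro x hx; obtain ⟨P, hP⟩ := hA x hx; exact ⟨P, hP, by simp⟩
  | succ k ih =>
    intro x hx
    rw [Function.iterate_succ_apply'] at hx
    have hacc := hx.2
    rw [mem_derivedSet, AccPt] at hacc
    set B := cbD^[k] A with hB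
    obtain ⟨P0, -⟩ := ih x hx.1
    have : ∀ y, ∃ P, y ∈ B → lgcbKern ρ P = y ∧ (k : ℕ∞) ≤ Order.coheight P := by
      intro y
      by_cases hy : y ∈ B
      · obtain ⟨P, hP⟩ := ih y hy
        exact ⟨P, fun _ => hP⟩
      · exact ⟨P0, fun h => absurd h hy⟩
    choose P hP using this
    let U := Ultrafilter.of (𝓝[≠] x ⊓ 𝓟 B)
    have hU : (U : Filter _) ≤ 𝓝[≠] x ⊓ 𝓟 B := Ultrafilter.of_le _
    have hUB : ∀ᶠ y in (U : Filter _), y ∈ B := hU (mem_inf_of_right (mem_principal_self B))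
    have hUx : ∀ᶠ y in (U : Filter _), y ≠ x :=
      hU (mem_inf_of_left self_mem_nhdsWithin)
    have hUn : (U : Filter _) ≤ 𝓝 x := hU.trans (inf_le_left.trans nhdsWithin_le_nhds)
    obtain ⟨Q, hQ, hle⟩ := lgcb_limit ρ U P x (by
      have : Tendsto id (U : Filter _) (𝓝 x) := hUn
      refine this.congr' ?_
      filter_upwards [hUB] with y hy
      exact (hP y hy).1.symm)
    refine ⟨Q, hQ, ?_⟩
    obtain ⟨y, ⟨hyB, hyx⟩, hy⟩ := ((hUB.and hUx).and hle).exists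
    have hlt : Q < P y := by
      refine lt_of_le_of_ne hy ?_
      intro h
      apply hyx
      rw [← hQ, h, (hP y hyB).1]
    have := Order.coheight_add_one_le hlt
    refine le_trans ?_ this
    push_cast
    gcongr
    exact (hP y hyB).2

theorem lgcb_free : ∃ f : FreeGroup (Fin 2) →* SL(2, ℤ), Function.Injective f := by
  let t : SL(2, ℤ) := ModularGroup.T ^ (2 : ℤ)
  let s : SL(2, ℤ) := ModularGroup.S
  let a : Fin 2 → SL(2, ℤ) := ![t, s * t * s⁻¹]
  let X0 : Set ℍ := {z | 1 ≤ z.re}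
  let Y0 : Set ℍ := {z | z.re < -1}
  let X : Fin 2 → Set ℍ := ![X0, {z | s⁻¹ • z ∈ X0}]
  let Y : Fin 2 → Set ℍ := ![Y0, {z | s⁻¹ • z ∈ Y0}]
  have ht : ∀ z : ℍ, (t • z).re = z.re + 2 := by
    intro z
    simp only [t, modular_T_zpow_smul]
    simp [add_comm]
  have ht' : ∀ z : ℍ, (t⁻¹ • z).re = z.re - 2 := by
    intro z
    have := ht (t⁻¹ • z)
    rw [smul_inv_smul] at this
    linarith
  have hs : ∀ z : ℍ, (s⁻¹ • z).re * (z.re ^ 2 + z.im ^ 2) = - z.re := by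
    intro z
    have h : s • (s⁻¹ • z) = s • (s • z) := by
      rw [smul_inv_smul, smul_smul]
      simp only [s, modular_S_smul, ← smul_smul]
      ext <;> simp
    have h := smul_left_cancel _ h
    rw [h]
    have hp : z.re ^ 2 + z.im ^ 2 ≠ 0 := by have := z.im_pos; positivity
    simp only [s, modular_S_smul]
    have : (mk (-z : ℂ)⁻¹ z.im_inv_neg_coe_pos).re = - z.re / (z.re ^ 2 + z.im ^ 2) := by
      change ((-z : ℂ)⁻¹).re = _
      simp [Complex.inv_re, Complex.normSq_apply, pow_two, neg_div]
    rw [this]; field_simp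
  have key : ∀ z : ℍ, (1 ≤ |z.re|) → |(s⁻¹ • z).re| < 1 := by
    intro z hz
    have h := hs z
    have hi := z.im_pos
    by_contra! hc
    have h2 := congrArg abs h
    rw [abs_mul, abs_neg, abs_of_pos (by positivity : 0 < z.re ^ 2 + z.im ^ 2), ← sq_abs z.re] at h2
    nlinarith [pow_pos hi 2]
  have hX01 : ∀ z : ℍ, z ∈ X0 → 1 ≤ |z.re| := fun z hz => le_trans hz (le_abs_self _)
  have hY01 : ∀ z : ℍ, z ∈ Y0 → 1 ≤ |z.re| := fun z hz => by
    have : z.re < -1 := hz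
    rw [abs_of_neg (by linarith)]; linarith
  have hXX : ∀ z : ℍ, z ∈ X0 → s⁻¹ • z ∈ X0 → False := fun z h1 h2 =>
    absurd (key z (hX01 z h1)) (not_lt.2 (hX01 _ h2))
  have hYY : ∀ z : ℍ, z ∈ Y0 → s⁻¹ • z ∈ Y0 → False := fun z h1 h2 =>
    absurd (key z (hY01 z h1)) (not_lt.2 (hY01 _ h2))
  have hXY : ∀ z : ℍ, z ∈ X0 → s⁻¹ • z ∈ Y0 → False := fun z h1 h2 =>
    absurd (key z (hX01 z h1)) (not_lt.2 (hY01 _ h2))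
  have hYX : ∀ z : ℍ, z ∈ Y0 → s⁻¹ • z ∈ X0 → False := fun z h1 h2 =>
    absurd (key z (hY01 z h1)) (not_lt.2 (hX01 _ h2))
  have h0 : ∀ z : ℍ, z ∈ X0 → z ∈ Y0 → False := fun z h1 h2 => by
    have h1 : 1 ≤ z.re := h1
    have h2 : z.re < -1 := h2
    linarith
  have htX : ∀ z : ℍ, z ∉ Y0 → t • z ∈ X0 := fun z h => by
    have h : ¬ z.re < -1 := h
    change 1 ≤ (t • z).re
    rw [ht]; linarith
  have htY : ∀ z : ℍ, z ∉ X0 → t⁻¹ • z ∈ Y0 := fun z h => by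
    have h : ¬ 1 ≤ z.re := h
    change (t⁻¹ • z).re < -1
    rw [ht']; linarith
  have hne : t • (t • (UpperHalfPlane.I)) ∈ X0 := by
    change 1 ≤ (t • (t • (UpperHalfPlane.I))).re
    rw [ht, ht]; norm_num
  refine ⟨FreeGroup.lift a, FreeGroup.injective_lift_of_ping_pong a X Y ?_ ?_ ?_ ?_ ?_ ?_⟩
  · intro i
    fin_cases i
    · exact ⟨_, hne⟩
    · refine ⟨s • (t • t • UpperHalfPlane.I), ?_⟩
      change s⁻¹ • s • (t • t • UpperHalfPlane.I) ∈ X0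
      rw [inv_smul_smul]; exact hne
  · intro i j hij
    rw [Function.onFun, Set.disjoint_left]
    fin_cases i <;> fin_cases j
    · exact absurd rfl hij
    · exact fun z h1 h2 => hXX z h1 h2
    · exact fun z h1 h2 => hXX z h2 h1
    · exact absurd rfl hij
  · intro i j hij
    rw [Function.onFun, Set.disjoint_left]
    fin_cases i <;> fin_cases j
    · exact absurd rfl hij
    · exact fun z h1 h2 => hYY z h1 h2
    · exact fun z h1 h2 => hYY z h2 h1
    · exact absurd rfl hij
  · intro i j
    rw [Set.disjoint_left]
    fin_cases i <;> fin_cases j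
    · exact fun z h1 h2 => h0 z h1 h2
    · exact fun z h1 h2 => hXY z h1 h2
    · exact fun z h1 h2 => hYX z h2 h1
    · exact fun z h1 h2 => h0 _ h1 h2
  · intro i
    rw [Set.smul_set_subset_iff]
    fin_cases i
    · exact fun z hz => htX z hz
    · intro z hz
      change s⁻¹ • ((s * t * s⁻¹) • z) ∈ X0
      rw [smul_smul, mul_assoc, inv_mul_cancel_left, ← smul_smul]
      exact htX _ hz
  · intro i
    rw [Set.smul_set_subset_iff]
    fin_cases i
    · exact fun z hz => htY z hz
    · intro z hz
      change s⁻¹ • ((s * t * s⁻¹)⁻¹ • z) ∈ Y0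
      rw [smul_smul, mul_inv_rev, mul_inv_rev, inv_inv, inv_mul_cancel_left, ← smul_smul]
      exact htY _ hz

abbrev LgcbPoly (n : ℕ) := MvPolynomial (Fin n × Fin 2 × Fin 2) ℤ

/-- The generic matrix. -/
noncomputable def lgcbMat (n : ℕ) (a : Fin n) : Matrix (Fin 2) (Fin 2) (LgcbPoly n) :=
  Matrix.of fun i j => MvPolynomial.X (a, i, j)

/-- The coordinate ring of `SL_2 ^ n`. -/
abbrev LgcbRing (n : ℕ) := LgcbPoly n ⧸ Ideal.span (Set.range fun a => (lgcbMat n a).det - 1)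

/-- The generic matrix of determinant one. -/
noncomputable def lgcbGen (n : ℕ) (a : Fin n) :
    Matrix.SpecialLinearGroup (Fin 2) (LgcbRing n) :=
  ⟨(lgcbMat n a).map (Ideal.Quotient.mk _), by
    have := RingHom.map_det (Ideal.Quotient.mk
      (Ideal.span (Set.range fun a => (lgcbMat n a).det - 1))) (lgcbMat n a)
    rw [RingHom.mapMatrix_apply] at this
    rw [← this, ← map_one (Ideal.Quotient.mk _), Ideal.Quotient.eq]
    exact Ideal.subset_span ⟨a, rfl⟩⟩

/-- The generic representation. -/
noncomputable def lgcbRho (n : ℕ) :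
    FreeGroup (Fin n) →* Matrix.SpecialLinearGroup (Fin 2) (LgcbRing n) :=
  FreeGroup.lift (lgcbGen n)

theorem lgcb_dim (n : ℕ) : ∃ d : ℕ, ∀ P : PrimeSpectrum (LgcbRing n), Order.coheight P ≤ d := by
  obtain ⟨d, hd⟩ : ∃ d : ℕ, ringKrullDim (LgcbRing n) ≤ d := by
    refine ⟨1 + Nat.card (Fin n × Fin 2 × Fin 2), (ringKrullDim_quotient_le _).trans ?_⟩
    rw [MvPolynomial.ringKrullDim_of_isNoetherianRing]
    push_cast
    gcongr
    exact Ring.krullDimLE_iff.1 inferInstance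
  refine ⟨d, fun P => ?_⟩
  have := (Order.coheight_le_krullDim P).trans hd
  exact_mod_cast this

theorem lgcb_eval (n : ℕ) (φ : FreeGroup (Fin n) →* SL(2, ℤ)) :
    ∃ P : PrimeSpectrum (LgcbRing n), ∀ w, lgcbKern (lgcbRho n) P w = true ↔ φ w = 1 := by
  let e0 : LgcbPoly n →+* ℤ :=
    MvPolynomial.eval fun p => (φ (FreeGroup.of p.1)).1 p.2.1 p.2.2
  have he0 : ∀ a, e0.mapMatrix (lgcbMat n a) = (φ (FreeGroup.of a)).1 := by
    intro a
    ext i j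
    simp [e0, lgcbMat]
  let e : LgcbRing n →+* ℤ := Ideal.Quotient.lift _ e0 (by
    intro f hf
    change f ∈ RingHom.ker e0
    revert f
    change Ideal.span _ ≤ _
    rw [Ideal.span_le]
    rintro _ ⟨a, rfl⟩
    change e0 _ = 0
    rw [map_sub, RingHom.map_det, he0, map_one, (φ (FreeGroup.of a)).2, sub_self])
  have he : (Matrix.SpecialLinearGroup.map e).comp (lgcbRho n) = φ := by
    ext a i j
    have := congrFun (congrFun (he0 a) i) j
    rw [MonoidHom.comp_apply, lgcbRho, FreeGroup.lift_apply_of]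
    exact this
  refine ⟨⟨RingHom.ker e, RingHom.ker_isPrime e⟩, fun w => ?_⟩
  rw [lgcbKern, lgcb_chi, ← he, Matrix.SpecialLinearGroup.ext_iff]
  change (∀ i j, e _ = 0) ↔ _
  refine forall_congr' fun i => forall_congr' fun j => ?_
  rw [map_sub, sub_eq_zero]
  have : e ((1 : Matrix (Fin 2) (Fin 2) (LgcbRing n)) i j) = (1 : Matrix (Fin 2) (Fin 2) ℤ) i j := by
    rw [Matrix.one_apply, Matrix.one_apply]; split_ifs <;> simp
  rw [this]
  rfl

theorem lgcb_base (n : ℕ) (x : FreeGroup (Fin n) → Bool) (hx : x ∈ LnSet n) :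
    ∃ P, lgcbKern (lgcbRho n) P = x := by
  classical
  obtain ⟨N, hN, hF, rfl⟩ := hx
  obtain ⟨f, hf⟩ := lgcb_free
  have : ∀ S : Finset (FreeGroup (Fin n)), ∃ P, ∀ w ∈ S,
      lgcbKern (lgcbRho n) P w = chi (N : Set (FreeGroup (Fin n))) w := by
    intro S
    obtain ⟨φ, hφ⟩ := hF (S.image (QuotientGroup.mk' N))
    obtain ⟨P, hP⟩ := lgcb_eval n ((f.comp φ).comp (QuotientGroup.mk' N))
    refine ⟨P, fun w hw => ?_⟩
    rw [Bool.eq_iff_iff, hP, lgcb_chi]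
    have h1 : (QuotientGroup.mk' N w = 1) ↔ w ∈ N := QuotientGroup.eq_one_iff w
    rw [SetLike.mem_coe, ← h1]
    constructor
    · intro h
      by_contra hne
      refine hφ _ (Finset.mem_image_of_mem _ hw) hne (hf ?_)
      rw [map_one]; exact h
    · intro h
      rw [MonoidHom.comp_apply, h, map_one]
  choose P hP using this
  obtain ⟨Q, hQ, -⟩ := lgcb_limit (lgcbRho n) (Ultrafilter.of atTop) P
    (chi (N : Set (FreeGroup (Fin n)))) (by
      refine Tendsto.mono_left ?_ (Ultrafilter.of_le _)
      rw [tendsto_pi_nhds]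
      intro w
      refine tendsto_nhds_of_eventually_eq ?_
      filter_upwards [eventually_ge_atTop {w}] with S hS
      exact hP S w (hS (Finset.mem_singleton_self w)))
  exact ⟨Q, hQ⟩

end

/-- Every point of `L_n` has finite Cantor–Bendixson rank in `L_n`: for every normal
subgroup `N` of `F_n` with `F_n / N` fully residually free there is `k ∈ ℕ` with
`N ∉ D^k(L_n)`.  Equivalently, the Cantor–Bendixson rank of every limit group is
finite. -/
theorem limit_groups_finite_CB_rank (n : ℕ) (hn : 1 ≤ n)
    (N : Subgroup (FreeGroup (Fin n))) [hN : N.Normal]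
    (hL : FullyResiduallyFree (FreeGroup (Fin n) ⧸ N)) :
    ∃ k : ℕ, chi (N : Set (FreeGroup (Fin n))) ∉ cbD^[k] (LnSet n) := by
  obtain ⟨d, hd⟩ := lgcb_dim n
  refine ⟨d + 1, fun h => ?_⟩
  obtain ⟨P, -, hP⟩ := lgcb_rank (lgcbRho n) (LnSet n) (lgcb_base n) (d + 1) _ h
  have := hP.trans (hd P)
  norm_cast at this
  omega
end

section
/- For n ≥ 1, a point N ∈ L_n is an isolated point of the space L_n if and only if the quotient F_n/N is isomorphic to the trivial group, or to the infinite cyclic group ℤ, or to the free group of rank 2. (In terms of the rank Rk = CB + 1 of marked limit groups, this says Rk(L) = 1 iff L ≅ 1, L ≅ ℤ, or L ≅ F_2.) -/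
/-- Upper unipotent matrix. -/
def upM {R : Type*} [CommRing R] (t : R) : Matrix.SpecialLinearGroup (Fin 2) R :=
  ⟨!![1, t; 0, 1], by simp [Matrix.det_fin_two]⟩

/-- Lower unipotent matrix. -/
def loM {R : Type*} [CommRing R] (t : R) : Matrix.SpecialLinearGroup (Fin 2) R :=
  ⟨!![1, 0; t, 1], by simp [Matrix.det_fin_two]⟩

theorem upM_add {R : Type*} [CommRing R] (s t : R) : upM (s + t) = upM s * upM t := by
  apply Subtype.ext
  change !![1, s + t; 0, 1] = !![1, s; 0, 1] * !![1, t; 0, 1]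
  simp [Matrix.mul_fin_two, add_comm]

theorem upM_zero {R : Type*} [CommRing R] : upM (0 : R) = 1 := by
  ext i j; fin_cases i <;> fin_cases j <;> simp [upM]

theorem loM_add {R : Type*} [CommRing R] (s t : R) : loM (s + t) = loM s * loM t := by
  apply Subtype.ext
  change !![1, 0; s + t, 1] = !![1, 0; s, 1] * !![1, 0; t, 1]
  simp [Matrix.mul_fin_two]

theorem loM_zero {R : Type*} [CommRing R] : loM (0 : R) = 1 := by
  ext i j; fin_cases i <;> fin_cases j <;> simp [loM]

theorem upM_neg {R : Type*} [CommRing R] (t : R) : upM (-t) = (upM t)⁻¹ := by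
  rw [eq_inv_iff_mul_eq_one, ← upM_add]; simp [upM_zero]

theorem loM_neg {R : Type*} [CommRing R] (t : R) : loM (-t) = (loM t)⁻¹ := by
  rw [eq_inv_iff_mul_eq_one, ← loM_add]; simp [loM_zero]

theorem upM_pow {R : Type*} [CommRing R] (t : R) (k : ℕ) : (upM t) ^ k = upM (k * t) := by
  induction k with
  | zero => simp [upM_zero]
  | succ k ih => rw [pow_succ, ih, ← upM_add]; congr 1; push_cast; ring

theorem map_upM {R S : Type*} [CommRing R] [CommRing S] (f : R →+* S) (t : R) :
    Matrix.SpecialLinearGroup.map f (upM t) = upM (f t) := by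
  ext i j
  change f (!![1, t; 0, 1] i j) = !![1, f t; 0, 1] i j
  fin_cases i <;> fin_cases j <;> simp

theorem map_loM {R S : Type*} [CommRing R] [CommRing S] (f : R →+* S) (t : R) :
    Matrix.SpecialLinearGroup.map f (loM t) = loM (f t) := by
  ext i j
  change f (!![1, 0; t, 1] i j) = !![1, 0; f t, 1] i j
  fin_cases i <;> fin_cases j <;> simp

/-- Sanov generators. -/
def sanovGen : Fin 2 → Matrix.SpecialLinearGroup (Fin 2) ℤ := ![upM 2, loM 2]

/-- Action on nonzero vectors. -/
@[reducible] def nzAction :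
    MulAction (Matrix.SpecialLinearGroup (Fin 2) ℤ) {v : Fin 2 → ℤ // v ≠ 0} where
  smul g v := ⟨g • v.1, by
    intro h; exact v.2 (by rwa [smul_eq_zero_iff_eq] at h)⟩
  one_smul v := Subtype.ext (one_smul _ _)
  mul_smul g h v := Subtype.ext (mul_smul g h v.1)

theorem nz_iff (v : {v : Fin 2 → ℤ // v ≠ 0}) : v.1 0 ≠ 0 ∨ v.1 1 ≠ 0 := by
  by_contra h
  push Not at h
  exact v.2 (by ext i; fin_cases i <;> simp [h])

theorem upM_smul (t : ℤ) (v : Fin 2 → ℤ) : upM t • v = ![v 0 + t * v 1, v 1] := by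
  rw [Matrix.SpecialLinearGroup.smul_def]
  ext i; fin_cases i <;> simp [upM, Matrix.mulVec, dotProduct]

theorem loM_smul (t : ℤ) (v : Fin 2 → ℤ) : loM t • v = ![v 0, t * v 0 + v 1] := by
  rw [Matrix.SpecialLinearGroup.smul_def]
  ext i; fin_cases i <;> simp [loM, Matrix.mulVec, dotProduct]

theorem sanov_injective : Function.Injective (FreeGroup.lift sanovGen) := by
  letI := nzAction
  have hval : ∀ (g : Matrix.SpecialLinearGroup (Fin 2) ℤ) (v : {v : Fin 2 → ℤ // v ≠ 0}),
    (g • v).1 = g • v.1 := fun g v => rfl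
  have c1 : ∀ p q : ℤ, p ≠ 0 ∨ q ≠ 0 → ¬ ((p + q) * q < 0) → 0 ≤ (p + 2 * q - q) * q := by
    intro p q _ h; nlinarith
  have c2 : ∀ p q : ℤ, p ≠ 0 ∨ q ≠ 0 → ¬ (0 ≤ (p - q) * q) → (p + (-2) * q + q) * q < 0 := by
    intro p q _ h; nlinarith
  refine FreeGroup.injective_lift_of_ping_pong (α := {v : Fin 2 → ℤ // v ≠ 0}) sanovGen
    ![{v | 0 ≤ (v.1 0 - v.1 1) * v.1 1}, {v | v.1 0 = 0 ∨ 0 < (v.1 1 - v.1 0) * v.1 0}]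
    ![{v | (v.1 0 + v.1 1) * v.1 1 < 0}, {v | v.1 0 ≠ 0 ∧ (v.1 1 + v.1 0) * v.1 0 ≤ 0}]
    ?_ ?_ ?_ ?_ ?_ ?_
  · intro i
    fin_cases i
    · exact ⟨⟨![1, 0], by simp⟩, by simp⟩
    · exact ⟨⟨![0, 1], by simp⟩, by simp⟩
  · have : Disjoint ({v | 0 ≤ (v.1 0 - v.1 1) * v.1 1} : Set {v : Fin 2 → ℤ // v ≠ 0})
        {v | v.1 0 = 0 ∨ 0 < (v.1 1 - v.1 0) * v.1 0} := by
      rw [Set.disjoint_left]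
      intro v h1 h2
      have := nz_iff v
      simp only [Set.mem_setOf_eq] at h1 h2
      rcases h2 with h | h
      · have h3 : v.1 1 ≠ 0 := by tauto
        rw [h] at h1
        have := mul_self_pos.2 h3
        nlinarith
      · nlinarith [sq_nonneg (v.1 0 - v.1 1)]
    intro i j hij
    fin_cases i <;> fin_cases j
    · exact absurd rfl hij
    · exact this
    · exact this.symm
    · exact absurd rfl hij
  · have : Disjoint ({v | (v.1 0 + v.1 1) * v.1 1 < 0} : Set {v : Fin 2 → ℤ // v ≠ 0})
        {v | v.1 0 ≠ 0 ∧ (v.1 1 + v.1 0) * v.1 0 ≤ 0} := by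
      rw [Set.disjoint_left]
      intro v h1 h2
      simp only [Set.mem_setOf_eq] at h1 h2
      nlinarith [sq_nonneg (v.1 0 + v.1 1)]
    intro i j hij
    fin_cases i <;> fin_cases j
    · exact absurd rfl hij
    · exact this
    · exact this.symm
    · exact absurd rfl hij
  · intro i j
    rw [Set.disjoint_left]
    intro v
    have hv := nz_iff v
    fin_cases i <;> fin_cases j <;> simp only [Fin.zero_eta, Fin.mk_one, Matrix.cons_val_zero,
      Matrix.cons_val_one, Set.mem_setOf_eq]
    · intro h1 h2; nlinarith [sq_nonneg (v.1 1)]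
    · rintro h1 ⟨h2, h3⟩
      have := mul_self_pos.2 h2
      nlinarith [sq_nonneg (v.1 1)]
    · rintro (h1 | h1) h2
      · rw [h1] at h2; nlinarith [sq_nonneg (v.1 1)]
      · nlinarith [sq_nonneg (v.1 1), sq_nonneg (v.1 0)]
    · rintro (h1 | h1) ⟨h2, h3⟩
      · exact h2 h1
      · nlinarith [sq_nonneg (v.1 1), sq_nonneg (v.1 0)]
  · intro i
    rintro _ ⟨v, hv, rfl⟩
    have hnz := nz_iff v
    fin_cases i <;> simp [sanovGen, hval, upM_smul, loM_smul] at hv ⊢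
    · nlinarith
    · by_cases h : v.1 0 = 0
      · exact Or.inl h
      · right; have := hv h; nlinarith
  · intro i
    rintro _ ⟨v, hv, rfl⟩
    have hnz := nz_iff v
    fin_cases i <;> simp [sanovGen, hval, upM_smul, loM_smul, ← upM_neg, ← loM_neg] at hv ⊢
    · nlinarith
    · refine ⟨hv.1, ?_⟩
      nlinarith [hv.2]

/-- Twisted cyclic shift. -/
def xPerm {G : Type*} [Group G] (m : ℕ) (hm : 1 ≤ m) (b : G) : Equiv.Perm (G × ℕ) where
  toFun p := if p.2 + 1 < m then (p.1, p.2 + 1) else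
        if p.2 + 1 = m then (b * p.1, 0) else p
  invFun p := if p.2 < m then
        (if p.2 = 0 then (b⁻¹ * p.1, m - 1) else (p.1, p.2 - 1)) else p
  left_inv := by
    rintro ⟨g, j⟩
    by_cases h1 : j + 1 < m
    · simp [h1]
    · by_cases h2 : j + 1 = m
      · simp [h2, show 0 < m by omega]; omega
      · have h3 : ¬ j < m := by omega
        simp [h1, h2, h3]
  right_inv := by
    rintro ⟨g, j⟩
    by_cases h1 : j < m
    · by_cases h2 : j = 0
      · have h3 : m - 1 + 1 = m := by omega
        simp [h2, h3, show 0 < m by omega]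
      · have h3 : j - 1 + 1 = j := by omega
        simp [h1, h2, h3]
    · have h3 : ¬ j + 1 < m := by omega
      have h4 : ¬ j + 1 = m := by omega
      simp [h1, h3, h4]

/-- Fibrewise translation. -/
def aPerm {G : Type*} [Group G] (h : ℕ → G) : Equiv.Perm (G × ℕ) where
  toFun p := (h p.2 * p.1, p.2)
  invFun p := ((h p.2)⁻¹ * p.1, p.2)
  left_inv := by rintro ⟨g, j⟩; simp
  right_inv := by rintro ⟨g, j⟩; simp

/-- The images of the generators. -/
def ppGen (m : ℕ) : Option (Fin m) → FreeGroup (Fin 2)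
  | none => (FreeGroup.of (0 : Fin 2)) ^ m
  | some i => (FreeGroup.of (0 : Fin 2) ^ (i : ℕ))⁻¹ * FreeGroup.of (1 : Fin 2) *
          FreeGroup.of (0 : Fin 2) ^ (i : ℕ)

theorem pp_injective (m : ℕ) (hm : 1 ≤ m) :
    Function.Injective (FreeGroup.lift (ppGen m)) := by
  classical
  let b : FreeGroup (Option (Fin m)) := FreeGroup.of none
  let h : ℕ → FreeGroup (Option (Fin m)) :=
    fun j => if hj : j < m then FreeGroup.of (some ⟨j, hj⟩) else 1
  let x := xPerm m hm b
  let a := aPerm h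
  have hx1 : ∀ g j, j + 1 < m → x (g, j) = (g, j + 1) := by
    intro g j hj
    change (if _ then _ else _) = _
    simp [hj]
  have hx2 : ∀ g j, j + 1 = m → x (g, j) = (b * g, 0) := by
    intro g j hj
    change (if _ then _ else _) = _
    simp [hj]
  have hxp : ∀ i, i < m → ∀ g, (x ^ i) (g, 0) = (g, i) := by
    intro i
    induction i with
    | zero => simp
    | succ i ih =>
      intro hi g
      rw [pow_succ', Equiv.Perm.mul_apply, ih (by omega), hx1 _ _ hi]
  have hxm : ∀ g, (x ^ m) (g, 0) = (b * g, 0) := by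
    intro g
    obtain ⟨k, rfl⟩ : ∃ k, m = k + 1 := ⟨m - 1, by omega⟩
    rw [pow_succ', Equiv.Perm.mul_apply, hxp _ (by omega), hx2 _ _ rfl]
  let Ψ : FreeGroup (Fin 2) →* Equiv.Perm (FreeGroup (Option (Fin m)) × ℕ) := FreeGroup.lift ![x, a]
  set e := FreeGroup.lift (ppGen m) with he
  have hgen : ∀ o g, Ψ (e (FreeGroup.of o)) (g, 0) = (FreeGroup.of o * g, 0) := by
    intro o g
    rcases o with _ | i
    · simp [he, ppGen, Ψ, hxm, b]
    · simp only [he, Ψ, ppGen, FreeGroup.lift_apply_of, map_mul, map_inv, map_pow, Matrix.cons_val_zero,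
        Matrix.cons_val_one, Equiv.Perm.mul_apply]
      rw [hxp _ i.2, Equiv.Perm.inv_eq_iff_eq, hxp _ i.2]
      change (h i * g, _) = _
      simp [h]
  have key : ∀ s : FreeGroup (Option (Fin m)), ∀ g, Ψ (e s) (g, 0) = (s * g, 0) := by
    intro s
    induction s using FreeGroup.induction_on with
    | C1 => simp
    | of o => exact hgen o
    | inv_of o ih =>
      intro g
      rw [map_inv, map_inv, Equiv.Perm.inv_eq_iff_eq, ih]; simp
    | mul s t hs ht => intro g; rw [map_mul, map_mul, Equiv.Perm.mul_apply, ht, hs, mul_assoc]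
  rw [injective_iff_map_eq_one]
  intro s hs
  have := key s 1
  rw [hs] at this
  simpa using this.symm

/-- The polynomial family of representations. -/
noncomputable def polyGen (m : ℕ) :
    Option (Fin m) → Matrix.SpecialLinearGroup (Fin 2) (Polynomial ℤ)
  | none => upM ((m : Polynomial ℤ) * 2)
  | some i => (upM (((i : ℕ) : Polynomial ℤ) * 2 * Polynomial.X))⁻¹ * loM 2 *
      upM (((i : ℕ) : Polynomial ℤ) * 2 * Polynomial.X)

/-- Collapsing homomorphisms. -/
def colGen (m j : ℕ) : Option (Fin m) → FreeGroup (Fin 2)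
  | none => FreeGroup.of 0
  | some i => (FreeGroup.of 0 ^ ((i : ℕ) * j))⁻¹ * FreeGroup.of 1 * FreeGroup.of 0 ^ ((i : ℕ) * j)

/-- Evaluation of matrices of polynomials. -/
noncomputable def evM (u : ℤ) : Matrix.SpecialLinearGroup (Fin 2) (Polynomial ℤ) →*
    Matrix.SpecialLinearGroup (Fin 2) ℤ :=
  Matrix.SpecialLinearGroup.map (Polynomial.evalRingHom u)

theorem ev_one (m : ℕ) (s : FreeGroup (Option (Fin m))) :
    evM 1 (FreeGroup.lift (polyGen m) s) =
      FreeGroup.lift sanovGen (FreeGroup.lift (ppGen m) s) := by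
  have : (evM 1).comp (FreeGroup.lift (polyGen m)) =
      (FreeGroup.lift sanovGen).comp (FreeGroup.lift (ppGen m)) := by
    apply FreeGroup.ext_hom
    rintro (_ | i)
    · simp [evM, polyGen, ppGen, map_upM, map_loM, sanovGen, upM_pow]
    · simp [evM, polyGen, ppGen, map_upM, map_loM, sanovGen, upM_pow]
  exact DFunLike.congr_fun this s

theorem ev_col (m j : ℕ) (s : FreeGroup (Option (Fin m))) :
    evM ((m : ℤ) * j) (FreeGroup.lift (polyGen m) s) =
      FreeGroup.lift ![upM ((m : ℤ) * 2), loM 2] (FreeGroup.lift (colGen m j) s) := by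
  have : (evM ((m : ℤ) * j)).comp (FreeGroup.lift (polyGen m)) =
      (FreeGroup.lift ![upM ((m : ℤ) * 2), loM 2]).comp (FreeGroup.lift (colGen m j)) := by
    apply FreeGroup.ext_hom
    rintro (_ | i)
    · simp [evM, polyGen, colGen, map_upM]
    · have : ((i : ℕ) : ℤ) * 2 * (m * j) = i * j * (m * 2) := by ring
      simp [evM, polyGen, colGen, map_upM, map_loM, upM_pow, this]
  exact DFunLike.congr_fun this s

theorem finite_bad (g : Matrix.SpecialLinearGroup (Fin 2) (Polynomial ℤ)) (hg : g ≠ 1) :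
    {u : ℤ | evM u g = 1}.Finite := by
  have : ∃ i j, g.1 i j ≠ (1 : Matrix (Fin 2) (Fin 2) (Polynomial ℤ)) i j := by
    by_contra h
    push Not at h
    exact hg (Subtype.ext (Matrix.ext h))
  obtain ⟨i, j, hij⟩ := this
  have hne : g.1 i j - (1 : Matrix (Fin 2) (Fin 2) (Polynomial ℤ)) i j ≠ 0 := sub_ne_zero.2 hij
  refine (Polynomial.finite_setOf_isRoot hne).subset ?_
  intro u hu
  have h1 : (evM u g).1 i j = (1 : Matrix (Fin 2) (Fin 2) ℤ) i j := by
    rw [show evM u g = 1 from hu]; rfl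
  have h2 : (g.1 i j).eval u = (1 : Matrix (Fin 2) (Fin 2) ℤ) i j := h1
  change Polynomial.IsRoot _ _
  rw [Polynomial.IsRoot, Polynomial.eval_sub, h2]
  fin_cases i <;> fin_cases j <;> simp

theorem exists_noninj (m : ℕ) (hm : 2 ≤ m) (S : Finset (FreeGroup (Option (Fin m)))) :
    ∃ φ : FreeGroup (Option (Fin m)) →* FreeGroup (Fin 2),
      (∀ s ∈ S, s ≠ 1 → φ s ≠ 1) ∧ ¬ Function.Injective φ := by
  classical
  have hR : ∀ s : FreeGroup (Option (Fin m)), s ≠ 1 → FreeGroup.lift (polyGen m) s ≠ 1 := by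
    intro s hs h
    have := ev_one m s
    rw [h, map_one] at this
    have h1 := (injective_iff_map_eq_one _).1 sanov_injective _ this.symm
    exact hs ((injective_iff_map_eq_one _).1 (pp_injective m (by omega)) _ h1)
  have hfin : (⋃ s ∈ (S.filter (· ≠ 1)), {u : ℤ | evM u (FreeGroup.lift (polyGen m) s) = 1}).Finite := by
    apply Set.Finite.biUnion (Finset.finite_toSet _)
    intro s hs
    exact finite_bad _ (hR s (by simpa using (Finset.mem_filter.1 hs).2))
  have hinj : Function.Injective (fun j : ℕ => (m : ℤ) * j) := by
    intro j k h
    have hm0 : (m : ℤ) ≠ 0 := by positivity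
    exact_mod_cast mul_left_cancel₀ hm0 h
  obtain ⟨j, hj⟩ := (hfin.preimage hinj.injOn).exists_notMem
  refine ⟨FreeGroup.lift (colGen m j), ?_, ?_⟩
  · intro s hs hs1 h
    apply hj
    simp only [Set.mem_preimage, Set.mem_iUnion]
    refine ⟨s, by simp [hs, hs1], ?_⟩
    change _ = _
    rw [ev_col, h, map_one]
  · intro h
    let b : FreeGroup (Option (Fin m)) := FreeGroup.of none
    let a0 : FreeGroup (Option (Fin m)) := FreeGroup.of (some ⟨0, by omega⟩)
    let a1 : FreeGroup (Option (Fin m)) := FreeGroup.of (some ⟨1, by omega⟩)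
    have h1 : a1 = (b ^ j)⁻¹ * a0 * b ^ j := by
      apply h
      simp [a0, a1, b, colGen]
    let θ : FreeGroup (Option (Fin m)) →* Multiplicative ℤ := FreeGroup.lift (fun o =>
      if o = some ⟨1, by omega⟩ then Multiplicative.ofAdd 1 else 1)
    have h2 := congrArg θ h1
    simp [a0, a1, b, θ] at h2

theorem exists_noninj' (X : Type) [Finite X] (hX : 3 ≤ Nat.card X) (S : Finset (FreeGroup X)) :
    ∃ φ : FreeGroup X →* FreeGroup (Fin 2),
      (∀ s ∈ S, s ≠ 1 → φ s ≠ 1) ∧ ¬ Function.Injective φ := by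
  classical
  have : Nat.card X = Nat.card (Option (Fin (Nat.card X - 1))) := by
    simp; omega
  obtain ⟨e⟩ := (Finite.card_eq).1 this
  let E := FreeGroup.freeGroupCongr e
  obtain ⟨φ, h1, h2⟩ := exists_noninj (Nat.card X - 1) (by omega) (S.image E)
  refine ⟨φ.comp E.toMonoidHom, ?_, ?_⟩
  · intro s hs hs1
    exact h1 (E s) (Finset.mem_image_of_mem _ hs) (by simpa using hs1)
  · intro h
    apply h2
    intro x y hxy
    have := @h (E.symm x) (E.symm y) (by simpa using hxy)
    simpa using this

theorem F2_residually_finite (s : FreeGroup (Fin 2)) (hs : s ≠ 1) :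
    ∃ p : ℕ, ∃ _ : NeZero p,
      ∃ φ : FreeGroup (Fin 2) →* Matrix.SpecialLinearGroup (Fin 2) (ZMod p), φ s ≠ 1 := by
  have h1 : FreeGroup.lift sanovGen s ≠ 1 := fun h =>
    hs ((injective_iff_map_eq_one _).1 sanov_injective _ h)
  set g := FreeGroup.lift sanovGen s with hg
  have : ∃ i j, g.1 i j ≠ (1 : Matrix (Fin 2) (Fin 2) ℤ) i j := by
    by_contra h
    push Not at h
    exact h1 (Subtype.ext (Matrix.ext h))
  obtain ⟨i, j, hij⟩ := this
  set d := g.1 i j - (1 : Matrix (Fin 2) (Fin 2) ℤ) i j with hd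
  have hd0 : d ≠ 0 := sub_ne_zero.2 hij
  refine ⟨d.natAbs + 1, inferInstance,
    (Matrix.SpecialLinearGroup.map (Int.castRingHom _)).comp (FreeGroup.lift sanovGen), ?_⟩
  intro h
  have h2 : ((g.1 i j : ℤ) : ZMod (d.natAbs + 1)) =
      (1 : Matrix (Fin 2) (Fin 2) (ZMod (d.natAbs + 1))) i j := by
    have := congrArg (fun M => M.1 i j) h
    exact this
  have h3 : ((d : ℤ) : ZMod (d.natAbs + 1)) = 0 := by
    rw [hd, Int.cast_sub, h2]
    fin_cases i <;> fin_cases j <;> simp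
  rw [ZMod.intCast_zmod_eq_zero_iff_dvd] at h3
  have := Int.natAbs_dvd_natAbs.2 h3
  have := Nat.le_of_dvd (Int.natAbs_pos.2 hd0) this
  omega

theorem finite_hom (n : ℕ) (Q : Type) [Group Q] [Finite Q] : Finite (FreeGroup (Fin n) →* Q) :=
  Finite.of_equiv _ FreeGroup.lift

theorem F2_hopfian (f : FreeGroup (Fin 2) →* FreeGroup (Fin 2)) (hf : Function.Surjective f) :
    Function.Injective f := by
  rw [injective_iff_map_eq_one]
  intro s hs
  by_contra hne
  obtain ⟨p, _, φ, hφ⟩ := F2_residually_finite s hne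
  have := finite_hom 2 (Matrix.SpecialLinearGroup (Fin 2) (ZMod p))
  have hinj : Function.Injective
      (fun ψ : FreeGroup (Fin 2) →* Matrix.SpecialLinearGroup (Fin 2) (ZMod p) => ψ.comp f) := by
    intro a b hab
    exact (MonoidHom.cancel_right hf).1 hab
  obtain ⟨ψ, hψ⟩ := Finite.surjective_of_injective hinj φ
  apply hφ
  rw [← hψ]
  simp [hs]

theorem card_le_of_surj (n : ℕ) (X : Type) (f : FreeGroup (Fin n) →* FreeGroup X)
    (hf : Function.Surjective f) : Finite X ∧ Nat.card X ≤ n := by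
  classical
  let Q := Multiplicative (ZMod 2)
  let F : (X → Q) → (Fin n → Q) := fun u => FreeGroup.lift.symm ((FreeGroup.lift u).comp f)
  have hF : Function.Injective F := by
    intro a b hab
    have := FreeGroup.lift.symm.injective hab
    exact FreeGroup.lift.injective ((MonoidHom.cancel_right hf).1 this)
  have hfin : Finite (X → Q) := Finite.of_injective F hF
  have hX : Finite X := by
    refine Finite.of_injective
      (fun x : X => (fun y => if y = x then Multiplicative.ofAdd 1 else 1 : X → Q)) ?_
    intro x y hxy
    by_contra hne
    have := congrFun hxy x
    simp only [hne, if_true, if_false] at this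
    exact absurd (show (1 : ZMod 2) = 0 from this) (by decide)
  refine ⟨hX, ?_⟩
  have := Nat.card_le_card_of_injective F hF
  simp only [Nat.card_pi, Q] at this
  have h2 : Nat.card (Multiplicative (ZMod 2)) = 2 := by simp [Nat.card_eq_fintype_card]
  have _ := Fintype.ofFinite X
  simp at this
  rw [Nat.card_eq_fintype_card]
  exact (Nat.pow_le_pow_iff_right (by norm_num)).1 this

/-- A noncommuting pair in `F₂` generates freely. -/
theorem F2_nonab_injective (f : FreeGroup (Fin 2) →* FreeGroup (Fin 2))
    (hf : f (FreeGroup.of 0 * FreeGroup.of 1) ≠ f (FreeGroup.of 1 * FreeGroup.of 0)) :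
    Function.Injective f := by
  let e := IsFreeGroup.toFreeGroup f.range
  let X := IsFreeGroup.Generators f.range
  have hs : Function.Surjective (e.toMonoidHom.comp f.rangeRestrict) :=
    e.surjective.comp f.rangeRestrict_surjective
  obtain ⟨hX, hc⟩ := card_le_of_surj 2 X _ hs
  have hne : e (f.rangeRestrict (FreeGroup.of 0 * FreeGroup.of 1)) ≠
      e (f.rangeRestrict (FreeGroup.of 1 * FreeGroup.of 0)) := by
    intro h
    exact hf (congrArg Subtype.val (e.injective h))
  have h2 : Nat.card X = 2 := by
    by_contra hne2
    have h1 : Nat.card X ≤ 1 := by omega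
    have : Subsingleton X := (Finite.card_le_one_iff_subsingleton).1 h1
    apply hne
    rcases isEmpty_or_nonempty X with hE | hN
    · exact Subsingleton.elim (α := FreeGroup X) _ _
    · let _ : Unique X := ⟨⟨hN.some⟩, fun a => Subsingleton.elim _ _⟩
      have hcm : ∀ a b : FreeGroup X, a * b = b * a := by
        intro a b
        have E : FreeGroup X ≃* Multiplicative ℤ := FreeGroup.mulEquivIntOfUnique
        apply E.injective
        rw [map_mul, map_mul, mul_comm]
      rw [map_mul, map_mul, hcm, ← map_mul, ← map_mul]
  have e2 : X ≃ Fin 2 := Finite.equivFinOfCardEq h2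
  let E := FreeGroup.freeGroupCongr e2
  have := F2_hopfian (E.toMonoidHom.comp (e.toMonoidHom.comp f.rangeRestrict))
    (E.surjective.comp hs)
  intro x y hxy
  apply this
  have : f.rangeRestrict x = f.rangeRestrict y := Subtype.ext hxy
  simp [this]

theorem chi_eq_iff {G : Type*} (s t : Set G) (g : G) :
    chi s g = chi t g ↔ (g ∈ s ↔ g ∈ t) := by
  simp [chi]

theorem chi_injective {G : Type*} {s t : Set G} (h : chi s = chi t) : s = t := by
  ext g
  exact (chi_eq_iff s t g).1 (congrFun h g)

theorem isolated_iff_finset (n : ℕ) (N : Subgroup (FreeGroup (Fin n))) [hN : N.Normal]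
    (hL : FullyResiduallyFree (FreeGroup (Fin n) ⧸ N)) :
    chi (N : Set (FreeGroup (Fin n))) ∉ cbD (LnSet n) ↔
      ∃ T : Finset (FreeGroup (Fin n)), ∀ (M : Subgroup (FreeGroup (Fin n))) (_ : M.Normal),
        FullyResiduallyFree (FreeGroup (Fin n) ⧸ M) → (∀ t ∈ T, (t ∈ M ↔ t ∈ N)) → M = N := by
  have hmem : chi (N : Set (FreeGroup (Fin n))) ∈ LnSet n := ⟨N, hN, hL, rfl⟩
  rw [cbD, Set.mem_inter_iff, mem_derivedSet, accPt_iff_nhds]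
  constructor
  · intro h
    have h' : ¬ ∀ U ∈ nhds (chi (N : Set (FreeGroup (Fin n)))), ∃ y ∈ U ∩ LnSet n,
      y ≠ chi (N : Set (FreeGroup (Fin n))) := fun h2 => h ⟨hmem, h2⟩
    push Not at h'
    obtain ⟨U, hU, hU2⟩ := h'
    rw [nhds_pi, Filter.mem_pi'] at hU
    obtain ⟨T, t, ht, hT⟩ := hU
    refine ⟨T, fun M hM hF hag => ?_⟩
    have h3 := hU2 (chi (M : Set (FreeGroup (Fin n)))) ⟨hT ?_, M, hM, hF, rfl⟩
    · exact SetLike.coe_injective (chi_injective h3)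
    · intro g hg
      have : chi (M : Set (FreeGroup (Fin n))) g = chi (N : Set (FreeGroup (Fin n))) g :=
        (chi_eq_iff _ _ g).2 (hag g hg)
      rw [this]
      exact mem_of_mem_nhds (ht g)
  · rintro ⟨T, hT⟩ ⟨_, h⟩
    obtain ⟨y, ⟨hyU, M, hM, hF, rfl⟩, hne⟩ := h
      ((T : Set (FreeGroup (Fin n))).pi fun g => {chi (N : Set (FreeGroup (Fin n))) g})
      (set_pi_mem_nhds T.finite_toSet (fun g _ => by simp))
    apply hne
    rw [hT M hM hF]
    intro t ht
    exact (chi_eq_iff _ _ t).1 (hyU t ht)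

theorem frf_ker {G : Type*} [Group G] (f : G →* FreeGroup (Fin 2)) :
    FullyResiduallyFree (G ⧸ f.ker) := by
  intro S
  refine ⟨QuotientGroup.kerLift f, fun s _ hs h => hs ?_⟩
  exact (injective_iff_map_eq_one _).1 (QuotientGroup.kerLift_injective f) s h

theorem rigid (n k : ℕ) (N : Subgroup (FreeGroup (Fin n))) [hN : N.Normal]
    (e : (FreeGroup (Fin n) ⧸ N) ≃* FreeGroup (Fin k)) (E : Finset (FreeGroup (Fin k)))
    (hE1 : ∀ y ∈ E, y ≠ 1)
    (hE : ∀ (Q : Type) [Group Q], FullyResiduallyFree Q → ∀ f : FreeGroup (Fin k) →* Q,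
      (∀ y ∈ E, f y ≠ 1) → Function.Injective f) :
    ∃ T : Finset (FreeGroup (Fin n)), ∀ (M : Subgroup (FreeGroup (Fin n))) (_ : M.Normal),
        FullyResiduallyFree (FreeGroup (Fin n) ⧸ M) → (∀ t ∈ T, (t ∈ M ↔ t ∈ N)) → M = N := by
  classical
  let π : FreeGroup (Fin n) →* FreeGroup (Fin k) := e.toMonoidHom.comp (QuotientGroup.mk' N)
  have hπs : Function.Surjective π := e.surjective.comp (QuotientGroup.mk'_surjective N)
  have hπ : ∀ x, π x = 1 ↔ x ∈ N := by
    intro x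
    simp [π]
  choose r hr using fun i : Fin k => hπs (FreeGroup.of i)
  let s : FreeGroup (Fin k) →* FreeGroup (Fin n) := FreeGroup.lift r
  have hs : ∀ y, π (s y) = y := by
    intro y
    have : π.comp s = MonoidHom.id _ := by
      apply FreeGroup.ext_hom
      intro i
      simp [s, hr]
    exact DFunLike.congr_fun this y
  refine ⟨(Finset.univ.image fun i : Fin n => (FreeGroup.of i)⁻¹ * s (π (FreeGroup.of i))) ∪
    E.image s, ?_⟩
  intro M hM hF hag
  have hrel : ∀ x, (QuotientGroup.mk' M) (s (π x)) = QuotientGroup.mk' M x := by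
    intro x
    have : ((QuotientGroup.mk' M).comp s).comp π = QuotientGroup.mk' M := by
      apply FreeGroup.ext_hom
      intro i
      have h1 : (FreeGroup.of i)⁻¹ * s (π (FreeGroup.of i)) ∈ M := by
        rw [hag _ (Finset.mem_union_left _ (Finset.mem_image_of_mem _ (Finset.mem_univ i)))]
        rw [← hπ, map_mul, hs, map_inv]
        simp
      exact (QuotientGroup.eq.2 h1).symm
    exact DFunLike.congr_fun this x
  have hinj : Function.Injective ((QuotientGroup.mk' M).comp s) := by
    apply hE _ hF
    intro y hy h
    have h1 : s y ∈ M := (QuotientGroup.eq_one_iff _).1 h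
    rw [hag _ (Finset.mem_union_right _ (Finset.mem_image_of_mem _ hy)), ← hπ, hs] at h1
    exact hE1 y hy h1
  ext x
  rw [← hπ, ← QuotientGroup.eq_one_iff]
  change QuotientGroup.mk' M x = 1 ↔ _
  rw [← hrel]
  constructor
  · intro h
    exact (injective_iff_map_eq_one _).1 hinj _ h
  · intro h
    rw [h, map_one, map_one]

theorem rigid_zero (Q : Type) [Group Q] (f : FreeGroup (Fin 0) →* Q) : Function.Injective f :=
  Function.injective_of_subsingleton f

theorem rigid_one (Q : Type) [Group Q] (hQ : FullyResiduallyFree Q) (f : FreeGroup (Fin 1) →* Q)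
    (hf : f (FreeGroup.of 0) ≠ 1) : Function.Injective f := by
  obtain ⟨φ, hφ⟩ := hQ {f (FreeGroup.of 0)}
  have h1 := hφ _ (by simp) hf
  have h2 : Function.Injective ((φ.comp f).comp
      (FreeGroup.mulEquivIntOfUnique (α := Fin 1)).symm.toMonoidHom) := by
    rw [injective_iff_map_eq_one]
    intro z hz
    have h3 : z = (Multiplicative.ofAdd (1 : ℤ)) ^ (Multiplicative.toAdd z) := by
      rw [← ofAdd_zsmul]; simp
    rw [h3, map_zpow] at hz
    have h4 : ((φ.comp f).comp (FreeGroup.mulEquivIntOfUnique (α := Fin 1)).symm.toMonoidHom)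
        (Multiplicative.ofAdd (1 : ℤ)) = φ (f (FreeGroup.of 0)) := by
      have : (FreeGroup.mulEquivIntOfUnique (α := Fin 1)).symm (Multiplicative.ofAdd (1 : ℤ)) =
          FreeGroup.of 0 := by
        change (FreeGroup.of default : FreeGroup (Fin 1)) ^ (1 : ℤ) = _
        rw [zpow_one]; rfl
      simp [this]
    rw [h4, IsMulTorsionFree.zpow_eq_one_iff_right h1] at hz
    rw [h3, hz, zpow_zero]
  intro x y hxy
  have := @h2 (FreeGroup.mulEquivIntOfUnique x) (FreeGroup.mulEquivIntOfUnique y)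
    (by simp [hxy])
  simpa using this

theorem rigid_two (Q : Type) [Group Q] (hQ : FullyResiduallyFree Q) (f : FreeGroup (Fin 2) →* Q)
    (hf : f (FreeGroup.of 0 * FreeGroup.of 1 * (FreeGroup.of 1 * FreeGroup.of 0)⁻¹) ≠ 1) :
    Function.Injective f := by
  obtain ⟨φ, hφ⟩ :=
    hQ {f (FreeGroup.of 0 * FreeGroup.of 1 * (FreeGroup.of 1 * FreeGroup.of 0)⁻¹)}
  have h1 := hφ _ (by simp) hf
  have h2 : Function.Injective (φ.comp f) := by
    apply F2_nonab_injective
    intro h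
    apply h1
    change (φ.comp f) _ = 1
    rw [map_mul, map_inv, h, mul_inv_cancel]
  exact Function.Injective.of_comp h2

theorem F2_comm_ne : (FreeGroup.of 0 * FreeGroup.of 1 * (FreeGroup.of 1 * FreeGroup.of 0)⁻¹ :
    FreeGroup (Fin 2)) ≠ 1 := by
  intro h
  rw [mul_inv_eq_one] at h
  have := congrArg FreeGroup.toWord h
  revert this
  decide

/-- A point `N ∈ L_n` is isolated in `L_n` (i.e. `Rk(F_n/N) = 1`) if and only if
`F_n / N` is trivial, infinite cyclic, or free of rank 2. -/
theorem isolated_iff_trivial_or_Z_or_F2 (n : ℕ) (hn : 1 ≤ n)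
    (N : Subgroup (FreeGroup (Fin n))) [hN : N.Normal]
    (hL : FullyResiduallyFree (FreeGroup (Fin n) ⧸ N)) :
    chi (N : Set (FreeGroup (Fin n))) ∉ cbD (LnSet n) ↔
      (Nonempty ((FreeGroup (Fin n) ⧸ N) ≃* PUnit) ∨
        Nonempty ((FreeGroup (Fin n) ⧸ N) ≃* Multiplicative ℤ) ∨
        Nonempty ((FreeGroup (Fin n) ⧸ N) ≃* FreeGroup (Fin 2))) := by
  classical
  rw [isolated_iff_finset n N hL]
  constructor
  · rintro ⟨T, hT⟩
    have key : ∀ φ : (FreeGroup (Fin n) ⧸ N) →* FreeGroup (Fin 2),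
        (∀ s ∈ T.image (QuotientGroup.mk' N), s ≠ 1 → φ s ≠ 1) → Function.Injective φ := by
      intro φ hφ
      have hM := hT (φ.comp (QuotientGroup.mk' N)).ker inferInstance (frf_ker _) (by
        intro t ht
        rw [MonoidHom.mem_ker]
        constructor
        · intro h
          by_contra hne
          exact hφ _ (Finset.mem_image_of_mem _ ht)
            (fun h2 => hne ((QuotientGroup.eq_one_iff _).1 h2)) h
        · intro h
          have : QuotientGroup.mk' N t = 1 := (QuotientGroup.eq_one_iff _).2 h
          rw [MonoidHom.comp_apply, this, map_one])
      rw [injective_iff_map_eq_one]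
      intro q hq
      obtain ⟨x, rfl⟩ := QuotientGroup.mk'_surjective N q
      have : x ∈ (φ.comp (QuotientGroup.mk' N)).ker := hq
      rw [hM] at this
      exact (QuotientGroup.eq_one_iff _).2 this
    obtain ⟨φ, hφ⟩ := hL (T.image (QuotientGroup.mk' N))
    have hinj := key φ hφ
    let X := IsFreeGroup.Generators φ.range
    let e : (FreeGroup (Fin n) ⧸ N) ≃* FreeGroup X :=
      (MonoidHom.ofInjective hinj).trans (IsFreeGroup.toFreeGroup φ.range)
    obtain ⟨hX, -⟩ := card_le_of_surj n X (e.toMonoidHom.comp (QuotientGroup.mk' N))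
      (e.surjective.comp (QuotientGroup.mk'_surjective N))
    have hcard : Nat.card X < 3 := by
      by_contra h3
      obtain ⟨ψ, h1, h2⟩ := exists_noninj' X (by omega)
        ((T.image (QuotientGroup.mk' N)).image e)
      apply h2
      have := key (ψ.comp e.toMonoidHom) (by
        intro s hs hs1
        exact h1 (e s) (Finset.mem_image_of_mem _ hs) (by simpa using hs1))
      intro x y hxy
      have := @this (e.symm x) (e.symm y) (by simpa using hxy)
      simpa using this
    have f : X ≃ Fin (Nat.card X) := Finite.equivFin X
    let e' := e.trans (FreeGroup.freeGroupCongr f)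
    generalize Nat.card X = c at f e' hcard
    interval_cases c
    · left
      have : Subsingleton (FreeGroup (Fin n) ⧸ N) := e'.injective.subsingleton
      let _ : Unique (FreeGroup (Fin n) ⧸ N) := ⟨⟨1⟩, fun a => Subsingleton.elim _ _⟩
      exact ⟨MulEquiv.ofUnique⟩
    · right; left
      exact ⟨e'.trans FreeGroup.mulEquivIntOfUnique⟩
    · right; right
      exact ⟨e'⟩
  · rintro (⟨⟨e⟩⟩ | ⟨⟨e⟩⟩ | ⟨⟨e⟩⟩)
    · have e' : PUnit ≃* FreeGroup (Fin 0) := MulEquiv.ofUnique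
      exact rigid n 0 N (e.trans e') ∅ (by simp) (fun Q _ _ f _ => rigid_zero Q f)
    · refine rigid n 1 N (e.trans (FreeGroup.mulEquivIntOfUnique (α := Fin 1)).symm)
        {FreeGroup.of 0} ?_ ?_
      · simp
      · intro Q _ hQ f hf
        exact rigid_one Q hQ f (hf _ (by simp))
    · refine rigid n 2 N e
        {FreeGroup.of 0 * FreeGroup.of 1 * (FreeGroup.of 1 * FreeGroup.of 0)⁻¹} ?_ ?_
      · intro y hy
        rw [Finset.mem_singleton.1 hy]
        exact F2_comm_ne
      · intro Q _ hQ f hf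
        exact rigid_two Q hQ f (hf _ (by simp))
end

section
/- For every n ≥ 3, the trivial normal subgroup {1} of F_n = FreeGroup (Fin n) is not an isolated point of the space L_n; that is, every quantifier-free formula (equivalently, every basic clopen neighbourhood given by a finite set of equations and inequations in the generators) satisfied by the standard basis of F_n is also satisfied by the marked point of some limit group not isomorphic to F_n. (Equivalently, Rk(F_n) ≥ 2 for n ≥ 3.) -/
namespace TrivNotIso

open Matrix

/-- Upper unipotent matrix. -/
def upp {R : Type*} [CommRing R] (x : R) : SpecialLinearGroup (Fin 2) R :=
  ⟨!![1, x; 0, 1], by simp [Matrix.det_fin_two]⟩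

/-- Lower unipotent matrix. -/
def low {R : Type*} [CommRing R] (x : R) : SpecialLinearGroup (Fin 2) R :=
  ⟨!![1, 0; x, 1], by simp [Matrix.det_fin_two]⟩

/-- Underlying matrix. -/
def mt {R : Type*} [CommRing R] (M : SpecialLinearGroup (Fin 2) R) : Matrix (Fin 2) (Fin 2) R := ↑M

lemma mt_ext {R : Type*} [CommRing R] {M N : SpecialLinearGroup (Fin 2) R}
    (h : ∀ i j, mt M i j = mt N i j) : M = N := Matrix.SpecialLinearGroup.ext M N h

lemma mt_mul {R : Type*} [CommRing R] (M N : SpecialLinearGroup (Fin 2) R) :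
    mt (M * N) = mt M * mt N := Matrix.SpecialLinearGroup.coe_mul M N

lemma mt_one {R : Type*} [CommRing R] : mt (1 : SpecialLinearGroup (Fin 2) R) = 1 :=
  Matrix.SpecialLinearGroup.coe_one

lemma mt_upp {R : Type*} [CommRing R] (x : R) : mt (upp x) = !![1, x; 0, 1] := rfl

lemma mt_low {R : Type*} [CommRing R] (x : R) : mt (low x) = !![1, 0; x, 1] := rfl

lemma mt_map {R T : Type*} [CommRing R] [CommRing T] (g : R →+* T)
    (M : SpecialLinearGroup (Fin 2) R) (i j : Fin 2) :
    mt (SpecialLinearGroup.map g M) i j = g (mt M i j) := rfl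

lemma upp_add {R : Type*} [CommRing R] (x y : R) : upp (x + y) = upp x * upp y := by
  refine mt_ext fun i j => ?_
  fin_cases i <;> fin_cases j <;> simp [mt_upp, mt_mul, add_comm]

lemma low_add {R : Type*} [CommRing R] (x y : R) : low (x + y) = low x * low y := by
  refine mt_ext fun i j => ?_
  fin_cases i <;> fin_cases j <;> simp [mt_low, mt_mul, mt_map]

lemma upp_zpow (x k : ℤ) : upp x ^ k = upp (x * k) := by
  let f : Multiplicative ℤ →* SpecialLinearGroup (Fin 2) ℤ :=
    MonoidHom.mk' (fun z => upp z.toAdd) (fun a b => upp_add _ _)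
  have h := map_zpow f (Multiplicative.ofAdd x) k
  have h2 : f (Multiplicative.ofAdd x ^ k) = upp (x * k) := by
    simp [f, mul_comm]
  rw [← h2, h]; rfl

lemma low_zpow (x k : ℤ) : low x ^ k = low (x * k) := by
  let f : Multiplicative ℤ →* SpecialLinearGroup (Fin 2) ℤ :=
    MonoidHom.mk' (fun z => low z.toAdd) (fun a b => low_add _ _)
  have h := map_zpow f (Multiplicative.ofAdd x) k
  have h2 : f (Multiplicative.ofAdd x ^ k) = low (x * k) := by
    simp [f, mul_comm]
  rw [← h2, h]; rfl

/-- Images of the generators. -/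
def gen {R : Type*} [CommRing R] {n : ℕ} (c : Fin n × Fin 3 → R) (i : Fin n) :
    SpecialLinearGroup (Fin 2) R :=
  if i.val = 0 then upp 4 else if i.val = 1 then low (-4) else
    upp (4 * c (i, 0)) * low (-4 * c (i, 1)) * upp (4 * c (i, 2))

/-- The representation with parameters `c`. -/
def rep {R : Type*} [CommRing R] {n : ℕ} (c : Fin n × Fin 3 → R) :
    FreeGroup (Fin n) →* SpecialLinearGroup (Fin 2) R := FreeGroup.lift (gen c)

lemma map_upp {R T : Type*} [CommRing R] [CommRing T] (g : R →+* T) (x : R) :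
    SpecialLinearGroup.map g (upp x) = upp (g x) := by
  refine mt_ext fun i j => ?_
  fin_cases i <;> fin_cases j <;> simp [mt_upp, mt_map]

lemma map_low {R T : Type*} [CommRing R] [CommRing T] (g : R →+* T) (x : R) :
    SpecialLinearGroup.map g (low x) = low (g x) := by
  refine mt_ext fun i j => ?_
  fin_cases i <;> fin_cases j <;> simp [mt_low, mt_mul, mt_map]

lemma map_rep {R T : Type*} [CommRing R] [CommRing T] {n : ℕ} (g : R →+* T)
    (c : Fin n × Fin 3 → R) (s : FreeGroup (Fin n)) :
    SpecialLinearGroup.map g (rep c s) = rep (fun i => g (c i)) s := by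
  have : (SpecialLinearGroup.map g).comp (rep c) = rep (fun i => g (c i)) := by
    have hg4 : g 4 = 4 := map_ofNat g 4
    ext1 i
    simp only [MonoidHom.comp_apply, rep, FreeGroup.lift_apply_of, gen]
    split_ifs <;> simp [map_upp, map_low, hg4]
  exact DFunLike.congr_fun this s

/-- The rational parameters giving parabolic elements. -/
def cQ {n : ℕ} (x : Fin n × Fin 3) : ℚ :=
  if x.2 = 0 then (1 - x.1.val) / (4 * x.1.val)
  else if x.2 = 1 then x.1.val ^ 2 else - (1 - x.1.val) / (4 * x.1.val)

/-- The parabolic matrix fixing `(1 - i, i)`. -/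
def par (e i : ℚ) : Matrix (Fin 2) (Fin 2) ℚ :=
  !![1 - e * 4 * ((1 - i) * i), e * 4 * (1 - i) ^ 2; - (e * 4 * i ^ 2), 1 + e * 4 * ((1 - i) * i)]

lemma gen_cQ {n : ℕ} (i : Fin n) :
    mt (gen (cQ (n := n)) i) = par 1 i.val := by
  unfold gen
  split_ifs with h0 h1
  · ext a b
    fin_cases a <;> fin_cases b <;> simp [mt_upp, par, h0]
  · ext a b
    fin_cases a <;> fin_cases b <;> simp [mt_low, par, h1]
  · have : (i.val : ℚ) ≠ 0 := by exact_mod_cast h0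
    ext a b
    fin_cases a <;> fin_cases b <;> simp [mt_mul, mt_upp, mt_low, par, cQ] <;>
      field_simp <;> ring

lemma gen_cQ_inv {n : ℕ} (i : Fin n) :
    mt (gen (cQ (n := n)) i)⁻¹ = par (-1) i.val := by
  have h : mt (gen (cQ (n := n)) i)⁻¹ = Matrix.adjugate (mt (gen (cQ (n := n)) i)) :=
    Matrix.SpecialLinearGroup.coe_inv _
  rw [h, gen_cQ, Matrix.adjugate_fin_two]
  ext a b
  fin_cases a <;> fin_cases b <;> simp [par, sub_eq_add_neg]

/-- Sign of a letter. -/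
def sg (b : Bool) : ℚ := cond b 1 (-1)

/-- The ping-pong invariant. -/
def Inv (i e : ℚ) (w : Fin 2 → ℚ) : Prop :=
  w 1 - i * (w 0 + w 1) ≠ 0 ∧
    2 * (w 1 - i * (w 0 + w 1)) ^ 2 ≤ e * (w 1 - i * (w 0 + w 1)) * (w 0 + w 1)

/-- The letter `j` may be applied. -/
def Wk (j : ℚ) (w : Fin 2 → ℚ) : Prop :=
  w 1 - j * (w 0 + w 1) ≠ 0 ∧ |w 0 + w 1| ≤ 2 * |w 1 - j * (w 0 + w 1)|

lemma par_g (e i : ℚ) (w : Fin 2 → ℚ) :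
    (par e i *ᵥ w) 1 - i * ((par e i *ᵥ w) 0 + (par e i *ᵥ w) 1) = w 1 - i * (w 0 + w 1) := by
  simp [par, Matrix.mulVec, dotProduct, Fin.sum_univ_two]; ring

lemma par_h (e i : ℚ) (w : Fin 2 → ℚ) :
    (par e i *ᵥ w) 0 + (par e i *ᵥ w) 1 = w 0 + w 1 + e * 4 * (w 1 - i * (w 0 + w 1)) := by
  simp [par, Matrix.mulVec, dotProduct, Fin.sum_univ_two]; ring

lemma inv_same (i e : ℚ) (he : e * e = 1) (w : Fin 2 → ℚ) (h : Inv i e w) :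
    Inv i e (par e i *ᵥ w) := by
  unfold Inv at *
  rw [par_g, par_h]
  refine ⟨h.1, h.2.trans ?_⟩
  generalize w 1 - i * (w 0 + w 1) = g
  have : e * g * (w 0 + w 1 + e * 4 * g) = e * g * (w 0 + w 1) + (e * e) * 4 * g ^ 2 := by ring
  rw [this, he]
  nlinarith [sq_nonneg g]

lemma inv_of_wk (i e : ℚ) (he : |e| = 1) (w : Fin 2 → ℚ) (h : Wk i w) :
    Inv i e (par e i *ᵥ w) := by
  unfold Inv Wk at *
  rw [par_g, par_h]
  refine ⟨h.1, ?_⟩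
  have h2 := h.2
  generalize w 1 - i * (w 0 + w 1) = g at *
  generalize w 0 + w 1 = k at *
  have e2 : e * e = 1 := by rw [← abs_mul_abs_self, he]; norm_num
  have : e * g * (k + e * 4 * g) = e * g * k + (e * e) * 4 * g ^ 2 := by ring
  rw [this, e2]
  have h3 : |e * g * k| ≤ 2 * g ^ 2 := by
    rw [abs_mul, abs_mul, he, ← sq_abs g]
    nlinarith [abs_nonneg g]
  have := neg_abs_le (e * g * k)
  linarith

lemma wk_of_inv (i j : ℕ) (hij : i ≠ j) (e : ℚ) (he : |e| = 1) (w : Fin 2 → ℚ)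
    (h : Inv i e w) : Wk j w := by
  unfold Inv Wk at *
  obtain ⟨h1, h2⟩ := h
  have hd : (1 : ℚ) ≤ |(i : ℚ) - j| := by
    have : (1 : ℤ) ≤ |(i : ℤ) - j| := Int.one_le_abs (by omega)
    exact_mod_cast this
  have key : w 1 - j * (w 0 + w 1) = (w 1 - i * (w 0 + w 1)) + ((i : ℚ) - j) * (w 0 + w 1) := by
    ring
  rw [key]
  generalize w 1 - i * (w 0 + w 1) = g at *
  generalize w 0 + w 1 = k at *
  have hg : 0 < |g| := abs_pos.mpr h1
  have h3 : 2 * |g| ≤ |k| := by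
    have : e * g * k ≤ |g| * |k| := by
      have := le_abs_self (e * g * k)
      rwa [abs_mul, abs_mul, he, one_mul] at this
    rw [← sq_abs g] at h2
    by_contra hc
    push Not at hc
    nlinarith
  have h4 : |k| - |g| ≤ |g + ((i : ℚ) - j) * k| := by
    have a1 : |((i : ℚ) - j) * k| ≤ |g + ((i : ℚ) - j) * k| + |g| := by
      have := abs_sub (g + ((i : ℚ) - j) * k) g
      simpa using this
    rw [abs_mul] at a1
    nlinarith [abs_nonneg k]
  refine ⟨?_, by linarith⟩
  rw [← abs_pos]; linarith

/-- Base vector. -/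
def w0 : Fin 2 → ℚ := ![2, -1]

lemma wk_w0 (j : ℕ) : Wk j w0 := by
  have h : (w0 1 - j * (w0 0 + w0 1)) = -(1 + (j : ℚ)) := by simp [w0]; ring
  have hj : (0 : ℚ) ≤ j := Nat.cast_nonneg j
  unfold Wk
  rw [h, abs_neg, abs_of_pos (by linarith : (0 : ℚ) < 1 + j)]
  refine ⟨by linarith, ?_⟩
  simp [w0]
  norm_num
  linarith

lemma not_inv_w0 (i : ℕ) (e : ℚ) (he : |e| = 1) : ¬ Inv i e w0 := by
  have h : (w0 1 - i * (w0 0 + w0 1)) = -(1 + (i : ℚ)) := by simp [w0]; ring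
  have hk : w0 0 + w0 1 = 1 := by simp [w0]; norm_num
  have hi : (0 : ℚ) ≤ i := Nat.cast_nonneg i
  unfold Inv
  rw [h, hk]
  rintro ⟨-, h2⟩
  have := neg_abs_le e
  rw [he] at this
  nlinarith

lemma abs_sg (b : Bool) : |sg b| = 1 := by cases b <;> simp [sg]

lemma sg_mul (b : Bool) : sg b * sg b = 1 := by cases b <;> simp [sg]

lemma rep_cons {n : ℕ} (a : Fin n × Bool) (L : List (Fin n × Bool)) (w : Fin 2 → ℚ) :
    mt (rep (cQ (n := n)) (FreeGroup.mk (a :: L))) *ᵥ w =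
      par (sg a.2) a.1.val *ᵥ (mt (rep (cQ (n := n)) (FreeGroup.mk L)) *ᵥ w) := by
  obtain ⟨i, b⟩ := a
  rw [Matrix.mulVec_mulVec]
  congr 1
  cases b
  · simp [rep, FreeGroup.lift_mk, sg, ← gen_cQ_inv, mt_mul]
  · simp [rep, FreeGroup.lift_mk, sg, ← gen_cQ, mt_mul]

lemma inv_word {n : ℕ} (L : List (Fin n × Bool)) : ∀ a : Fin n × Bool,
    FreeGroup.IsReduced (a :: L) →
    Inv a.1.val (sg a.2) (mt (rep (cQ (n := n)) (FreeGroup.mk (a :: L))) *ᵥ w0) := by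
  induction L with
  | nil =>
    intro a _
    rw [rep_cons]
    apply inv_of_wk _ _ (abs_sg _)
    have : FreeGroup.mk ([] : List (Fin n × Bool)) = 1 := rfl
    simpa [this, mt_one] using wk_w0 a.1.val
  | cons b L ih =>
    intro a h
    rw [FreeGroup.isReduced_cons_cons] at h
    have hb := ih b h.2
    rw [rep_cons]
    by_cases hab : a.1 = b.1
    · have h2 := h.1 hab
      rw [← hab, ← h2] at hb
      exact inv_same _ _ (sg_mul _) _ hb
    · apply inv_of_wk _ _ (abs_sg _)
      exact wk_of_inv b.1.val a.1.val (fun h => hab (Fin.ext h.symm)) _ (abs_sg _) _ hb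

lemma rep_cQ_ne {n : ℕ} (s : FreeGroup (Fin n)) (hs : s ≠ 1) : rep (cQ (n := n)) s ≠ 1 := by
  intro h
  have hr := FreeGroup.isReduced_toWord (x := s)
  have hm : FreeGroup.mk s.toWord = s := FreeGroup.mk_toWord
  cases hw : s.toWord with
  | nil => exact hs (FreeGroup.toWord_eq_nil_iff.mp hw)
  | cons a L =>
    rw [hw] at hr hm
    have := inv_word L a hr
    rw [hm, h] at this
    simp [mt_one] at this
    exact not_inv_w0 _ _ (abs_sg _) this

lemma exists_int {n : ℕ} (S : Finset (FreeGroup (Fin n))) :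
    ∃ c : Fin n × Fin 3 → ℤ, ∀ s ∈ S, s ≠ 1 → rep c s ≠ 1 := by
  classical
  let X : Fin n × Fin 3 → MvPolynomial (Fin n × Fin 3) ℤ := MvPolynomial.X
  have h1 : ∀ s : FreeGroup (Fin n), s ≠ 1 → ∃ a b : Fin 2,
      mt (rep X s) a b - (1 : Matrix (Fin 2) (Fin 2) _) a b ≠ 0 := by
    intro s hs
    by_contra hc
    push Not at hc
    have : rep X s = 1 := by
      refine mt_ext fun a b => ?_
      rw [mt_one]
      rw [← sub_eq_zero, hc a b]
    have h2 := map_rep (MvPolynomial.aeval (cQ (n := n)) :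
      MvPolynomial (Fin n × Fin 3) ℤ →ₐ[ℤ] ℚ).toRingHom X s
    rw [this, map_one] at h2
    apply rep_cQ_ne s hs
    rw [h2]
    congr 2
    ext i
    simp [X]
  choose! a b hab using h1
  let P : MvPolynomial (Fin n × Fin 3) ℤ := ∏ s ∈ S.filter (· ≠ 1),
    (mt (rep X s) (a s) (b s) - (1 : Matrix (Fin 2) (Fin 2) _) (a s) (b s))
  have hP : P ≠ 0 := by
    rw [Finset.prod_ne_zero_iff]
    intro s hs
    exact hab s (Finset.mem_filter.mp hs).2
  obtain ⟨c, hc⟩ : ∃ c, MvPolynomial.eval c P ≠ 0 := by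
    by_contra hc
    push Not at hc
    exact hP (MvPolynomial.funext (by simpa using hc))
  refine ⟨c, fun s hs hs1 h => ?_⟩
  rw [map_prod, Finset.prod_ne_zero_iff] at hc
  apply hc s (Finset.mem_filter.mpr ⟨hs, hs1⟩)
  have h2 := map_rep (MvPolynomial.eval c) X s
  have h3 : (fun i => MvPolynomial.eval c (X i)) = c := by ext i; simp [X]
  rw [h3, h] at h2
  have h4 := congrArg (fun M : SpecialLinearGroup (Fin 2) ℤ => mt M (a s) (b s)) h2
  simp only [mt_map, mt_one] at h4
  rw [map_sub, h4]
  by_cases hh : a s = b s <;> simp [Matrix.one_apply, hh]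

lemma exists_hom (n : ℕ) (hn : 3 ≤ n) (S : Finset (FreeGroup (Fin n))) :
    ∃ φ : FreeGroup (Fin n) →* FreeGroup (Fin 2), (∀ s ∈ S, s ≠ 1 → φ s ≠ 1) ∧ φ.ker ≠ ⊥ := by
  obtain ⟨c, hc⟩ := exists_int S
  let A : FreeGroup (Fin 2) := FreeGroup.of 0
  let B : FreeGroup (Fin 2) := FreeGroup.of 1
  let φ : FreeGroup (Fin n) →* FreeGroup (Fin 2) := FreeGroup.lift fun i =>
    if i.val = 0 then A else if i.val = 1 then B else A ^ c (i, 0) * B ^ c (i, 1) * A ^ c (i, 2)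
  let ψ : FreeGroup (Fin 2) →* SpecialLinearGroup (Fin 2) ℤ :=
    FreeGroup.lift ![upp 4, low (-4)]
  have hψ : ψ.comp φ = rep c := by
    ext1 i
    simp only [MonoidHom.comp_apply, rep, FreeGroup.lift_apply_of, gen, φ]
    split_ifs <;> simp [ψ, A, B, upp_zpow, low_zpow]
  refine ⟨φ, fun s hs hs1 h => hc s hs hs1 ?_, fun hk => ?_⟩
  · rw [← hψ, MonoidHom.comp_apply, h, map_one]
  · let i0 : Fin n := ⟨0, by omega⟩
    let i1 : Fin n := ⟨1, by omega⟩
    let i2 : Fin n := ⟨2, by omega⟩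
    let z : FreeGroup (Fin n) := FreeGroup.of i2 *
      (FreeGroup.of i0 ^ c (i2, 0) * FreeGroup.of i1 ^ c (i2, 1) * FreeGroup.of i0 ^ c (i2, 2))⁻¹
    have hz : z ∈ φ.ker := by
      rw [MonoidHom.mem_ker]
      simp [z, φ, i0, i1, i2]
    rw [hk, Subgroup.mem_bot] at hz
    let χ : FreeGroup (Fin n) →* Multiplicative ℤ := FreeGroup.lift fun i =>
      if i.val = 2 then Multiplicative.ofAdd 1 else 1
    have h1 : χ z = Multiplicative.ofAdd 1 := by
      simp [z, χ, i0, i1, i2]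
    rw [hz, map_one] at h1
    exact absurd h1 (by decide)

end TrivNotIso

/-- For `n ≥ 3`, the trivial normal subgroup `{1}` of `F_n` is not an isolated point
of `L_n`: it is a non-isolated point of the subspace `L_n`, i.e. it belongs to
`D(L_n)`.  Equivalently `Rk(F_n) ≥ 2` for `n ≥ 3`. -/
theorem trivial_subgroup_not_isolated (n : ℕ) (hn : 3 ≤ n) :
    chi ((⊥ : Subgroup (FreeGroup (Fin n))) : Set (FreeGroup (Fin n))) ∈ cbD (LnSet n) := by
  classical
  refine ⟨⟨⊥, inferInstance, ?_, rfl⟩, ?_⟩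
  · intro S
    obtain ⟨φ, hφ, -⟩ := TrivNotIso.exists_hom n hn (S.image Quotient.out)
    refine ⟨QuotientGroup.lift ⊥ φ (by intro x hx; rw [Subgroup.mem_bot.mp hx]; exact one_mem _), ?_⟩
    intro s hs hs1
    have h := hφ (Quotient.out s) (Finset.mem_image_of_mem _ hs)
    have hq : ((Quotient.out s : FreeGroup (Fin n)) :
        FreeGroup (Fin n) ⧸ (⊥ : Subgroup (FreeGroup (Fin n)))) = s := Quotient.out_eq s
    rw [← hq, QuotientGroup.lift_mk]
    apply h
    intro h1
    apply hs1
    rw [← hq, h1]; rfl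
  · rw [mem_derivedSet, accPt_iff_nhds]
    intro U hU
    obtain ⟨V, hVU, hV, hxV⟩ := mem_nhds_iff.mp hU
    obtain ⟨I, u, hu, hI⟩ := isOpen_pi_iff.mp hV _ hxV
    obtain ⟨φ, hφ, hk⟩ := TrivNotIso.exists_hom n hn I
    refine ⟨chi (φ.ker : Set (FreeGroup (Fin n))), ⟨hVU (hI ?_), φ.ker, inferInstance, ?_, rfl⟩, ?_⟩
    · intro s hs
      have : chi (φ.ker : Set (FreeGroup (Fin n))) s =
          chi ((⊥ : Subgroup (FreeGroup (Fin n))) : Set (FreeGroup (Fin n))) s := by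
        unfold chi
        by_cases h1 : s = 1
        · simp [h1]
        · have := hφ s hs h1
          simp [h1, MonoidHom.mem_ker, this]
      rw [this]
      exact (hu s hs).2
    · intro S
      refine ⟨QuotientGroup.kerLift φ, fun s _ hs1 h => hs1 ?_⟩
      exact QuotientGroup.kerLift_injective φ (by rw [h, map_one])
    · intro h
      apply hk
      ext s
      have := congrFun h s
      simpa [chi] using this
end
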